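/- Let n ≥ 3. Then for each fixed t > 0, the supremum of u*(t) / ‖Δu‖_{L¹(ℝⁿ)} over all u ∈ W^{2,1}_{Δ,0}(ℝⁿ) with Δu ≠ 0 equals 2^{−2/n} N*_∞(t). -/

import Mathlib

open MeasureTheory Filter Topology
open scoped ENNReal

noncomputable section

/-- Euclidean space ℝⁿ. -/
abbrev Euc (n : ℕ) := EuclideanSpace ℝ (Fin n)

/-- The (pointwise) Laplacian of a function on ℝⁿ: the trace of the second derivative. -/
def lapl (n : ℕ) (φ : Euc n → ℝ) (x : Euc n) : ℝ :=
  ∑ i : Fin n,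
    iteratedFDeriv ℝ 2 φ x ![EuclideanSpace.single i (1 : ℝ), EuclideanSpace.single i (1 : ℝ)]

/-- A test function on Ω: smooth and compactly supported inside Ω. -/
def IsTestFun (n : ℕ) (Ω : Set (Euc n)) (φ : Euc n → ℝ) : Prop :=
  ContDiff ℝ (⊤ : ℕ∞) φ ∧ HasCompactSupport φ ∧ tsupport φ ⊆ Ω

/-- `u ∈ W₀^{1,1}(Ω)`: `u` is an L¹(Ω) limit of test functions whose gradients converge
in L¹(Ω) (i.e. `u` is in the closure of C_c^∞(Ω) in the W^{1,1} norm). -/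
def MemW0_1_1 (n : ℕ) (Ω : Set (Euc n)) (u : Euc n → ℝ) : Prop :=
  IntegrableOn u Ω volume ∧
  ∃ φ : ℕ → Euc n → ℝ, (∀ k, IsTestFun n Ω (φ k)) ∧
    Tendsto (fun k => ∫ x in Ω, |φ k x - u x|) atTop (𝓝 0) ∧
    ∃ g : Euc n → Euc n →L[ℝ] ℝ,
      IntegrableOn (fun x => ‖g x‖) Ω volume ∧
      Tendsto (fun k => ∫ x in Ω, ‖fderiv ℝ (φ k) x - g x‖) atTop (𝓝 0)

/-- `u ∈ W^{2,1}_Δ(Ω)` with distributional Laplacian `f ∈ L¹(Ω)`. -/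
def MemW21Delta (n : ℕ) (Ω : Set (Euc n)) (u f : Euc n → ℝ) : Prop :=
  MemW0_1_1 n Ω u ∧ IntegrableOn f Ω volume ∧
    ∀ ψ : Euc n → ℝ, IsTestFun n Ω ψ →
      ∫ x in Ω, u x * lapl n ψ x = ∫ x in Ω, f x * ψ x

/-- `u ∈ W^{2,1}_{Δ,0}(Ω)` with Laplacian `f`: `u` is an L¹(Ω) limit of test functions `φ k`
with `Δ(φ k) → f` in L¹(Ω) (closure of C_c^∞(Ω) in the norm ‖Δu‖₁). -/
def MemW21Delta0 (n : ℕ) (Ω : Set (Euc n)) (u f : Euc n → ℝ) : Prop :=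
  IntegrableOn u Ω volume ∧ IntegrableOn f Ω volume ∧
  ∃ φ : ℕ → Euc n → ℝ, (∀ k, IsTestFun n Ω (φ k)) ∧
    Tendsto (fun k => ∫ x in Ω, |φ k x - u x|) atTop (𝓝 0) ∧
    Tendsto (fun k => ∫ x in Ω, |lapl n (φ k) x - f x|) atTop (𝓝 0)

/-- The decreasing rearrangement `u*(t)` of `u` on Ω. -/
def decRearr (n : ℕ) (Ω : Set (Euc n)) (u : Euc n → ℝ) (t : ℝ) : ℝ :=
  sInf {s : ℝ | 0 ≤ s ∧ volume {x ∈ Ω | s < |u x|} ≤ ENNReal.ofReal t}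

/-- `‖f‖_{L¹(Ω)}`. -/
def L1norm (n : ℕ) (Ω : Set (Euc n)) (f : Euc n → ℝ) : ℝ := ∫ x in Ω, |f x|

/-- ω_{n-1}: surface measure of the unit sphere in ℝⁿ. -/
def omegaS (n : ℕ) : ℝ := 2 * Real.pi ^ ((n : ℝ) / 2) / Real.Gamma ((n : ℝ) / 2)

/-- c_n = 1/((n-2) ω_{n-1}). -/
def cConst (n : ℕ) : ℝ := 1 / (((n : ℝ) - 2) * omegaS n)

/-- `N*_V(t)`: the rearrangement of the Green function of the ball of volume V. -/
def NstarV (n : ℕ) (V t : ℝ) : ℝ :=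
  if n = 2 then (1 / (4 * Real.pi)) * Real.log (V / t)
  else cConst n * (omegaS n / (n : ℝ)) ^ (((n : ℝ) - 2) / (n : ℝ)) *
    (t ^ (-(((n : ℝ) - 2) / (n : ℝ))) - V ^ (-(((n : ℝ) - 2) / (n : ℝ))))

/-- `N*_∞(t)` (for n ≥ 3). -/
def NstarInf (n : ℕ) (t : ℝ) : ℝ :=
  cConst n * (omegaS n / (n : ℝ)) ^ (((n : ℝ) - 2) / (n : ℝ)) *
    t ^ (-(((n : ℝ) - 2) / (n : ℝ)))

/-- The maximal function `u**(t) = (1/t) ∫₀ᵗ u*(s) ds`. -/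
def maximalFn (n : ℕ) (Ω : Set (Euc n)) (u : Euc n → ℝ) (t : ℝ) : ℝ :=
  (1 / t) * ∫ s in (0:ℝ)..t, decRearr n Ω u s

/-- `u ∈ L_exp(Ω)`. -/
def MemLexp (n : ℕ) (Ω : Set (Euc n)) (u : Euc n → ℝ) : Prop :=
  ∃ M : ℝ, ∀ t : ℝ, 0 < t → t ≤ (volume Ω).toReal →
    decRearr n Ω u t / (1 + Real.log ((volume Ω).toReal / t)) ≤ M

/-- `u ∈ L_{exp,0}(Ω)`. -/
def MemLexp0 (n : ℕ) (Ω : Set (Euc n)) (u : Euc n → ℝ) : Prop :=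
  MemLexp n Ω u ∧
    Tendsto (fun t : ℝ => maximalFn n Ω u t / Real.log (1 / t)) (𝓝[>] 0) (𝓝 0)

/-- `u ∈ L^{n/(n-2),∞}(Ω)`. -/
def MemWeakL (n : ℕ) (Ω : Set (Euc n)) (u : Euc n → ℝ) : Prop :=
  ∃ M : ℝ, ∀ t : ℝ, 0 < t → t ≤ (volume Ω).toReal →
    t ^ (((n : ℝ) - 2) / (n : ℝ)) * decRearr n Ω u t ≤ M

/-- `u ∈ L₀^{n/(n-2),∞}(Ω)`. -/
def MemWeakL0 (n : ℕ) (Ω : Set (Euc n)) (u : Euc n → ℝ) : Prop :=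
  MemWeakL n Ω u ∧
    Tendsto (fun t : ℝ => t ^ (((n : ℝ) - 2) / (n : ℝ)) * maximalFn n Ω u t) (𝓝[>] 0) (𝓝 0)

/-- `Λ_n^0(Ω)`: equals `L_{exp,0}(Ω)` if n = 2 and `L₀^{n/(n-2),∞}(Ω)` if n ≥ 3. -/
def MemLambda0 (n : ℕ) (Ω : Set (Euc n)) (u : Euc n → ℝ) : Prop :=
  if n = 2 then MemLexp0 n Ω u else MemWeakL0 n Ω u

open Pointwise in
/-- One-dimensional Brunn–Minkowski inequality. -/
theorem volume_add_volume_le_of_add_subset {A B C : Set ℝ} (hA : MeasurableSet A)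
    (hB : MeasurableSet B) (hAn : A.Nonempty) (hBn : B.Nonempty) (hC : A + B ⊆ C) :
    volume A + volume B ≤ volume C := by
  obtain ⟨a₀, ha₀⟩ := hAn
  obtain ⟨b₀, hb₀⟩ := hBn
  have hAC : volume A ≤ volume C := by
    calc volume A = volume ((fun x => x + b₀) '' A) := by simp
      _ ≤ volume C := by
        refine measure_mono ?_
        rintro _ ⟨x, hx, rfl⟩
        exact hC (Set.add_mem_add hx hb₀)
  have hBC : volume B ≤ volume C := by
    calc volume B = volume ((fun x => a₀ + x) '' B) := by simp
      _ ≤ volume C := by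
        refine measure_mono ?_
        rintro _ ⟨x, hx, rfl⟩
        exact hC (Set.add_mem_add ha₀ hx)
  rcases eq_or_ne (volume A) 0 with hA0 | hA0
  · simpa [hA0] using hBC
  rcases eq_or_ne (volume B) 0 with hB0 | hB0
  · simpa [hB0] using hAC
  refine ENNReal.le_of_forall_lt_one_mul_le ?_ |>.trans le_rfl
  intro θ hθ
  by_cases hCtop : volume C = ⊤
  · simp [hCtop]
  have hAfin : volume A ≠ ⊤ := ne_top_of_le_ne_top hCtop hAC
  have hBfin : volume B ≠ ⊤ := ne_top_of_le_ne_top hCtop hBC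
  have hlt : ∀ v : ℝ≥0∞, v ≠ 0 → v ≠ ⊤ → θ * v < v := by
    intro v hv hv'
    calc θ * v < 1 * v := ENNReal.mul_lt_mul_left hv hv' hθ
      _ = v := one_mul v
  obtain ⟨K, hKA, hK, hKv⟩ := hA.exists_lt_isCompact (hlt _ hA0 hAfin)
  obtain ⟨L, hLB, hL, hLv⟩ := hB.exists_lt_isCompact (hlt _ hB0 hBfin)
  have hKn : K.Nonempty := by
    rw [Set.nonempty_iff_ne_empty]; rintro rfl; simp at hKv
  have hLn : L.Nonempty := by
    rw [Set.nonempty_iff_ne_empty]; rintro rfl; simp at hLv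
  obtain ⟨k, hkK, hk⟩ := hK.exists_isGreatest hKn
  obtain ⟨l, hlL, hl⟩ := hL.exists_isLeast hLn
  have h1 : volume ((fun x => x + l) '' K) = volume K := by simp
  have h2 : volume ((fun x => k + x) '' L) = volume L := by simp
  have hdisj : AEDisjoint volume ((fun x => x + l) '' K) ((fun x => k + x) '' L) := by
    have hsub : ((fun x => x + l) '' K) ∩ ((fun x => k + x) '' L) ⊆ {k + l} := by
      rintro z ⟨⟨x, hx, rfl⟩, ⟨y, hy, hxy⟩⟩
      have := hk hx
      have := hl hy
      simp only at hxy
      simp only [Set.mem_singleton_iff]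
      linarith
    exact measure_mono_null hsub (by simp)
  calc θ * (volume A + volume B) = θ * volume A + θ * volume B := mul_add _ _ _
    _ ≤ volume K + volume L := add_le_add hKv.le hLv.le
    _ = volume ((fun x => x + l) '' K ∪ (fun x => k + x) '' L) := by
        rw [measure_union₀ _ hdisj, h1, h2]
        exact (hL.image (by fun_prop)).measurableSet.nullMeasurableSet
    _ ≤ volume C := by
        refine measure_mono (Set.union_subset ?_ ?_)
        · rintro _ ⟨x, hx, rfl⟩
          exact hC (Set.add_mem_add (hKA hx) (hLB hlL))
        · rintro _ ⟨x, hx, rfl⟩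
          exact hC (Set.add_mem_add (hKA hkK) (hLB hx))

theorem ENNReal.rpow_mul_rpow_le_weighted_add {w₁ w₂ : ℝ} (h₁ : 0 < w₁) (h₂ : 0 < w₂)
    (hw : w₁ + w₂ = 1) (a b : ℝ≥0∞) :
    a ^ w₁ * b ^ w₂ ≤ ENNReal.ofReal w₁ * a + ENNReal.ofReal w₂ * b := by
  rcases eq_or_ne a ⊤ with rfl | ha
  · simp [ENNReal.mul_top, h₁]
  rcases eq_or_ne b ⊤ with rfl | hb
  · simp [ENNReal.mul_top, h₂]
  lift a to NNReal using ha
  lift b to NNReal using hb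
  have := NNReal.geom_mean_le_arith_mean2_weighted ⟨w₁, h₁.le⟩ ⟨w₂, h₂.le⟩ a b
    (NNReal.eq hw)
  rw [← ENNReal.coe_rpow_of_nonneg _ h₁.le, ← ENNReal.coe_rpow_of_nonneg _ h₂.le,
    ENNReal.ofReal, ENNReal.ofReal, Real.toNNReal_of_nonneg h₁.le, Real.toNNReal_of_nonneg h₂.le]
  exact_mod_cast this

open Pointwise in
theorem weighted_add_lintegral_le_of_sup_eq_one {w₁ w₂ : ℝ} (h₁ : 0 < w₁) (h₂ : 0 < w₂)
    (hw : w₁ + w₂ = 1) {f g h : ℝ → ℝ} (hf : Measurable f) (hg : Measurable g)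
    (hh : Measurable h) (hf0 : ∀ x, 0 ≤ f x) (hg0 : ∀ x, 0 ≤ g x) (hh0 : ∀ x, 0 ≤ h x)
    (hf1 : ∀ x, f x ≤ 1) (hg1 : ∀ x, g x ≤ 1)
    (hfs : ∀ s < 1, ∃ x, s < f x) (hgs : ∀ s < 1, ∃ x, s < g x)
    (H : ∀ x y, f x ^ w₁ * g y ^ w₂ ≤ h (w₁ * x + w₂ * y)) :
    ENNReal.ofReal w₁ * (∫⁻ x, ENNReal.ofReal (f x)) +
        ENNReal.ofReal w₂ * (∫⁻ x, ENNReal.ofReal (g x)) ≤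
       ∫⁻ x, ENNReal.ofReal (h x) := by
  rw [lintegral_eq_lintegral_meas_lt _ (ae_of_all _ hf0) hf.aemeasurable,
    lintegral_eq_lintegral_meas_lt _ (ae_of_all _ hg0) hg.aemeasurable,
    lintegral_eq_lintegral_meas_lt _ (ae_of_all _ hh0) hh.aemeasurable]
  have hm : ∀ φ : ℝ → ℝ, Measurable fun t : ℝ => volume {x | t < φ x} := by
    intro φ
    refine Antitone.measurable ?_
    intro s t hst
    exact measure_mono fun x (hx : t < φ x) => lt_of_le_of_lt hst hx
  rw [← lintegral_const_mul _ (hm f), ← lintegral_const_mul _ (hm g),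
    ← lintegral_add_left ((hm f).const_mul _)]
  refine setLIntegral_mono (hm h) ?_
  intro t (ht : 0 < t)
  rcases lt_or_ge t 1 with ht1 | ht1
  · have hs : ∀ (w : ℝ) (hw : 0 < w) (S : Set ℝ),
        ENNReal.ofReal w * volume S = volume (w • S) := by
      intro w hw S
      rw [Measure.addHaar_smul]; simp [abs_of_pos hw]
    rw [hs _ h₁, hs _ h₂]
    refine volume_add_volume_le_of_add_subset
      ((measurableSet_lt measurable_const hf).const_smul₀ _)
      ((measurableSet_lt measurable_const hg).const_smul₀ _)
      (Set.Nonempty.smul_set (hfs t ht1)) (Set.Nonempty.smul_set (hgs t ht1)) ?_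
    rintro _ ⟨_, ⟨x, hx, rfl⟩, _, ⟨y, hy, rfl⟩, rfl⟩
    simp only [Set.mem_ofPred_eq, smul_eq_mul] at hx hy ⊢
    calc t = t ^ w₁ * t ^ w₂ := by rw [← Real.rpow_add ht, hw, Real.rpow_one]
      _ < f x ^ w₁ * g y ^ w₂ := by
        exact mul_lt_mul'' (Real.rpow_lt_rpow ht.le hx h₁) (Real.rpow_lt_rpow ht.le hy h₂)
          (by positivity) (by positivity)
      _ ≤ _ := H x y
  · have e1 : {x | t < f x} = ∅ := by
      ext x; simpa using (hf1 x).trans ht1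
    have e2 : {x | t < g x} = ∅ := by
      ext x; simpa using (hg1 x).trans ht1
    simp [e1, e2]

theorem prekopa_leindler_real_of_bounded {w₁ w₂ : ℝ} (h₁ : 0 < w₁) (h₂ : 0 < w₂)
    (hw : w₁ + w₂ = 1) {f g h : ℝ → ℝ≥0∞} (hf : Measurable f) (hg : Measurable g)
    (hh : Measurable h) {K : ℝ≥0∞} (hK : K ≠ ⊤) (hfK : ∀ x, f x ≤ K) (hgK : ∀ x, g x ≤ K)
    (H : ∀ x y, f x ^ w₁ * g y ^ w₂ ≤ h (w₁ * x + w₂ * y)) :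
    (∫⁻ x, f x) ^ w₁ * (∫⁻ x, g x) ^ w₂ ≤ ∫⁻ x, h x := by
  set A := ⨆ x, f x with hA
  set B := ⨆ x, g x with hB
  have hfA : ∀ x, f x ≤ A := le_iSup f
  have hgB : ∀ x, g x ≤ B := le_iSup g
  have hAt : A ≠ ⊤ := ne_top_of_le_ne_top hK (iSup_le hfK)
  have hBt : B ≠ ⊤ := ne_top_of_le_ne_top hK (iSup_le hgK)
  rcases eq_or_ne A 0 with hA0 | hA0
  · have : ∀ x, f x = 0 := fun x => le_antisymm ((hfA x).trans hA0.le) bot_le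
    simp [this, ENNReal.zero_rpow_of_pos h₁]
  rcases eq_or_ne B 0 with hB0 | hB0
  · have : ∀ x, g x = 0 := fun x => le_antisymm ((hgB x).trans hB0.le) bot_le
    simp [this, ENNReal.zero_rpow_of_pos h₂]
  set D := A ^ w₁ * B ^ w₂ with hD
  have hD0 : D ≠ 0 := by
    simp only [hD, ne_eq, mul_eq_zero, not_or]
    exact ⟨(ENNReal.rpow_pos (pos_iff_ne_zero.2 hA0) hAt).ne',
      (ENNReal.rpow_pos (pos_iff_ne_zero.2 hB0) hBt).ne'⟩
  have hDt : D ≠ ⊤ := ENNReal.mul_ne_top (ENNReal.rpow_ne_top_of_nonneg h₁.le hAt)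
    (ENNReal.rpow_ne_top_of_nonneg h₂.le hBt)
  have key : ∀ (φ : ℝ → ℝ≥0∞) (M : ℝ≥0∞), Measurable φ → M ≠ 0 → M ≠ ⊤ → (∀ x, φ x ≤ M) →
      ∫⁻ x, φ x = M * ∫⁻ x, ENNReal.ofReal (φ x / M).toReal := by
    intro φ M hφ hM hMt hφM
    rw [← lintegral_const_mul _ (by fun_prop)]
    refine lintegral_congr fun x => ?_
    rw [ENNReal.ofReal_toReal (ENNReal.div_ne_top (ne_top_of_le_ne_top hMt (hφM x)) hM),
      ENNReal.mul_div_cancel hM hMt]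
  have div_le : ∀ {a M : ℝ≥0∞}, a ≤ M → a / M ≤ 1 := fun h => ENNReal.div_le_of_le_mul (by simpa)
  have main := weighted_add_lintegral_le_of_sup_eq_one h₁ h₂ hw
    (f := fun x => (f x / A).toReal) (g := fun x => (g x / B).toReal)
    (h := fun x => (min (h x / D) 1).toReal)
    (by fun_prop) (by fun_prop) (by fun_prop) (fun _ => ENNReal.toReal_nonneg)
    (fun _ => ENNReal.toReal_nonneg) (fun _ => ENNReal.toReal_nonneg)
    (fun x => by simpa using ENNReal.toReal_mono ENNReal.one_ne_top (div_le (hfA x)))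
    (fun x => by simpa using ENNReal.toReal_mono ENNReal.one_ne_top (div_le (hgB x)))
    ?_ ?_ ?_
  · calc (∫⁻ x, f x) ^ w₁ * (∫⁻ x, g x) ^ w₂
        = D * ((∫⁻ x, ENNReal.ofReal (f x / A).toReal) ^ w₁ *
            (∫⁻ x, ENNReal.ofReal (g x / B).toReal) ^ w₂) := by
          rw [key f A hf hA0 hAt hfA, key g B hg hB0 hBt hgB,
            ENNReal.mul_rpow_of_nonneg _ _ h₁.le, ENNReal.mul_rpow_of_nonneg _ _ h₂.le, hD]
          ring
      _ ≤ D * ∫⁻ x, ENNReal.ofReal (min (h x / D) 1).toReal := by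
          gcongr
          exact (ENNReal.rpow_mul_rpow_le_weighted_add h₁ h₂ hw _ _).trans main
      _ ≤ ∫⁻ x, h x := by
          rw [← lintegral_const_mul _ (by fun_prop)]
          refine lintegral_mono fun x => ?_
          rw [ENNReal.ofReal_toReal (ne_top_of_le_ne_top ENNReal.one_ne_top (min_le_right _ _))]
          calc D * min (h x / D) 1 ≤ D * (h x / D) := by gcongr; exact min_le_left _ _
            _ = h x := ENNReal.mul_div_cancel hD0 hDt
  · intro s hs
    rcases lt_or_ge s 0 with h0 | h0
    · exact ⟨0, h0.trans_le ENNReal.toReal_nonneg⟩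
    have : ENNReal.ofReal s * A < ⨆ x, f x := by
      calc ENNReal.ofReal s * A < 1 * A := ENNReal.mul_lt_mul_left hA0 hAt (by simpa using hs)
        _ = _ := one_mul _
    obtain ⟨x, hx⟩ := lt_iSup_iff.1 this
    refine ⟨x, ?_⟩
    rw [← ENNReal.ofReal_lt_iff_lt_toReal h0
      (ENNReal.div_ne_top (ne_top_of_le_ne_top hAt (hfA x)) hA0)]
    exact (ENNReal.lt_div_iff_mul_lt (Or.inl hA0) (Or.inl hAt)).2 hx
  · intro s hs
    rcases lt_or_ge s 0 with h0 | h0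
    · exact ⟨0, h0.trans_le ENNReal.toReal_nonneg⟩
    have : ENNReal.ofReal s * B < ⨆ x, g x := by
      calc ENNReal.ofReal s * B < 1 * B := ENNReal.mul_lt_mul_left hB0 hBt (by simpa using hs)
        _ = _ := one_mul _
    obtain ⟨x, hx⟩ := lt_iSup_iff.1 this
    refine ⟨x, ?_⟩
    rw [← ENNReal.ofReal_lt_iff_lt_toReal h0
      (ENNReal.div_ne_top (ne_top_of_le_ne_top hBt (hgB x)) hB0)]
    exact (ENNReal.lt_div_iff_mul_lt (Or.inl hB0) (Or.inl hBt)).2 hx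
  · intro x y
    simp only [ENNReal.toReal_rpow]
    rw [← ENNReal.toReal_mul]
    refine ENNReal.toReal_mono (ne_top_of_le_ne_top ENNReal.one_ne_top (min_le_right _ _))
      (le_min ?_ ?_)
    · rw [ENNReal.div_rpow_of_nonneg _ _ h₁.le, ENNReal.div_rpow_of_nonneg _ _ h₂.le]
      refine le_trans (le_of_eq ?_) (ENNReal.div_le_div_right (H x y) D)
      rw [hD, div_eq_mul_inv, div_eq_mul_inv, div_eq_mul_inv, ENNReal.mul_inv]
      · ring
      · exact Or.inr (ENNReal.rpow_ne_top_of_nonneg h₂.le hBt)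
      · exact Or.inl (ENNReal.rpow_ne_top_of_nonneg h₁.le hAt)
    · exact mul_le_one' (ENNReal.rpow_le_one (div_le (hfA x)) h₁.le)
        (ENNReal.rpow_le_one (div_le (hgB y)) h₂.le)

theorem prekopa_leindler_real {w₁ w₂ : ℝ} (h₁ : 0 < w₁) (h₂ : 0 < w₂)
    (hw : w₁ + w₂ = 1) {f g h : ℝ → ℝ≥0∞} (hf : Measurable f) (hg : Measurable g)
    (hh : Measurable h) (H : ∀ x y, f x ^ w₁ * g y ^ w₂ ≤ h (w₁ * x + w₂ * y)) :
    (∫⁻ x, f x) ^ w₁ * (∫⁻ x, g x) ^ w₂ ≤ ∫⁻ x, h x := by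
  rcases eq_or_ne (∫⁻ x, f x) 0 with hf0 | hf0
  · simp [hf0, ENNReal.zero_rpow_of_pos h₁]
  rcases eq_or_ne (∫⁻ x, g x) 0 with hg0 | hg0
  · simp [hg0, ENNReal.zero_rpow_of_pos h₂]
  have lim : ∀ φ : ℝ → ℝ≥0∞, Measurable φ →
      Tendsto (fun k : ℕ => ∫⁻ x, min (φ x) k) atTop (𝓝 (∫⁻ x, φ x)) := by
    intro φ hφ
    refine lintegral_tendsto_of_tendsto_of_monotone (fun k => by fun_prop)
      (ae_of_all _ fun x a b hab => ?_) (ae_of_all _ fun x => ?_)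
    · exact min_le_min le_rfl (by exact_mod_cast hab)
    · have := (tendsto_const_nhds (x := φ x)).min ENNReal.tendsto_nat_nhds_top
      simpa using this
  have t1 := ((ENNReal.continuous_rpow_const (y := w₁)).tendsto _).comp (lim f hf)
  have t2 := ((ENNReal.continuous_rpow_const (y := w₂)).tendsto _).comp (lim g hg)
  have n1 : (∫⁻ x, f x) ^ w₁ ≠ 0 := by
    simp [ENNReal.rpow_eq_zero_iff, hf0, h₁.le]
  have n2 : (∫⁻ x, g x) ^ w₂ ≠ 0 := by
    simp [ENNReal.rpow_eq_zero_iff, hg0, h₂.le]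
  refine le_of_tendsto (ENNReal.Tendsto.mul t1 (Or.inl n1) t2 (Or.inl n2))
    (Eventually.of_forall fun k => ?_)
  refine prekopa_leindler_real_of_bounded h₁ h₂ hw (by fun_prop) (by fun_prop) hh
    (K := k) (by simp) (fun x => min_le_right _ _) (fun x => min_le_right _ _) fun x y => ?_
  refine le_trans ?_ (H x y)
  gcongr <;> exact min_le_left _ _

/-- The Prékopa–Leindler inequality. -/
theorem prekopa_leindler {w₁ w₂ : ℝ} (h₁ : 0 < w₁) (h₂ : 0 < w₂) (hw : w₁ + w₂ = 1) :
    ∀ (n : ℕ) {f g h : (Fin n → ℝ) → ℝ≥0∞}, Measurable f → Measurable g → Measurable h →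
      (∀ x y, f x ^ w₁ * g y ^ w₂ ≤ h (w₁ • x + w₂ • y)) →
      (∫⁻ x, f x) ^ w₁ * (∫⁻ x, g x) ^ w₂ ≤ ∫⁻ x, h x := by
  intro n
  induction n with
  | zero =>
    intro f g h hf hg hh H
    have e : ∀ φ : (Fin 0 → ℝ) → ℝ≥0∞, ∫⁻ x, φ x = φ 0 := by
      intro φ
      rw [lintegral_unique, Measure.volume_pi_eq_dirac 0]
      rw [measure_univ, mul_one]
      exact congrArg φ (Subsingleton.elim _ _)
    rw [e, e, e]
    simpa using H 0 0
  | succ n ih =>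
    intro f g h hf hg hh H
    have mp := (volume_preserving_piFinSuccAbove (fun _ : Fin (n + 1) => ℝ) 0).symm
    have hme : Measurable fun p : ℝ × (Fin n → ℝ) => (Fin.cons p.1 p.2 : Fin (n + 1) → ℝ) := by
      have := mp.measurable
      convert this using 1
      ext p i
      simp [MeasurableEquiv.piFinSuccAbove]
    have e : ∀ φ : (Fin (n + 1) → ℝ) → ℝ≥0∞, Measurable φ →
        ∫⁻ x, φ x = ∫⁻ a : ℝ, ∫⁻ y : Fin n → ℝ, φ (Fin.cons a y) := by
      intro φ hφ
      rw [← mp.lintegral_comp hφ, Measure.volume_eq_prod, lintegral_prod _ (by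
        exact (hφ.comp mp.measurable).aemeasurable)]
      refine lintegral_congr fun a => lintegral_congr fun y => ?_
      simp [MeasurableEquiv.piFinSuccAbove, Fin.consEquiv]
    have m : ∀ φ : (Fin (n + 1) → ℝ) → ℝ≥0∞, Measurable φ →
        Measurable fun a : ℝ => ∫⁻ y : Fin n → ℝ, φ (Fin.cons a y) :=
      fun φ hφ => (hφ.comp hme).lintegral_prod_right'
    rw [e f hf, e g hg, e h hh]
    refine prekopa_leindler_real h₁ h₂ hw (m f hf) (m g hg) (m h hh) fun a b => ?_
    have hs : ∀ a : ℝ, Measurable fun y : Fin n → ℝ => (Fin.cons a y : Fin (n + 1) → ℝ) :=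
      fun a => hme.comp measurable_prodMk_left
    refine ih (hf.comp (hs a)) (hg.comp (hs b)) (hh.comp (hs _)) fun x y => ?_
    refine (H (Fin.cons a x) (Fin.cons b y)).trans (le_of_eq ?_)
    congr 1
    ext i
    refine Fin.cases ?_ (fun j => ?_) i <;> simp

theorem prekopa_leindler_euclidean {w₁ w₂ : ℝ} (h₁ : 0 < w₁) (h₂ : 0 < w₂) (hw : w₁ + w₂ = 1)
    {n : ℕ} {f g h : Euc n → ℝ≥0∞} (hf : Measurable f) (hg : Measurable g) (hh : Measurable h)
    (H : ∀ x y, f x ^ w₁ * g y ^ w₂ ≤ h (w₁ • x + w₂ • y)) :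
    (∫⁻ x, f x) ^ w₁ * (∫⁻ x, g x) ^ w₂ ≤ ∫⁻ x, h x := by
  have mp := PiLp.volume_preserving_toLp (Fin n)
  rw [← mp.lintegral_comp hf, ← mp.lintegral_comp hg, ← mp.lintegral_comp hh]
  refine prekopa_leindler h₁ h₂ hw n (hf.comp mp.measurable) (hg.comp mp.measurable)
    (hh.comp mp.measurable) fun x y => ?_
  simpa using H (WithLp.toLp 2 x) (WithLp.toLp 2 y)

/-- The Brunn–Minkowski inequality when one of the two sets is a ball. -/
theorem ofReal_pow_le_volume_of_thickening_subset {n : ℕ} {E C : Set (Euc n)}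
    (hE : MeasurableSet E) (hC : MeasurableSet C) {a b ε : ℝ} (ha : 0 < a) (hb : 0 < b)
    (hε : 0 < ε) (hEa : volume E = ENNReal.ofReal (a ^ n))
    (hκ : volume (Metric.ball (0 : Euc n) 1) = ENNReal.ofReal (b ^ n))
    (hsub : Metric.thickening ε E ⊆ C) :
    ENNReal.ofReal ((a + ε * b) ^ n) ≤ volume C := by
  set S := a + ε * b with hS
  have hS0 : 0 < S := by positivity
  have h₁ : 0 < a / S := by positivity
  have h₂ : 0 < ε * b / S := by positivity
  have hw : a / S + ε * b / S = 1 := by field_simp; exact hS.symm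
  have hm : MeasurableSet {x : Euc n | (a / S) • x ∈ E} := hE.preimage (measurable_const_smul _)
  have hbm : MeasurableSet (Metric.ball (0 : Euc n) (S / b)) := Metric.isOpen_ball.measurableSet
  have key := prekopa_leindler_euclidean h₁ h₂ hw (n := n)
    (f := {x : Euc n | (a / S) • x ∈ E}.indicator fun _ => 1)
    (g := (Metric.ball (0 : Euc n) (S / b)).indicator fun _ => 1)
    (h := C.indicator fun _ => 1)
    (measurable_const.indicator hm) (measurable_const.indicator hbm)
    (measurable_const.indicator hC) ?_
  · rw [lintegral_indicator hm, lintegral_indicator hbm, lintegral_indicator hC] at key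
    simp only [lintegral_const, one_mul, Measure.restrict_apply_univ] at key
    have v1 : volume {x : Euc n | (a / S) • x ∈ E} = ENNReal.ofReal (S ^ n) := by
      have : {x : Euc n | (a / S) • x ∈ E} = (fun x => (a / S) • x) ⁻¹' E := rfl
      rw [this, Measure.addHaar_preimage_smul _ h₁.ne', hEa, ← ENNReal.ofReal_mul (by positivity)]
      congr 1
      rw [abs_of_pos (by positivity)]
      simp only [finrank_euclideanSpace, Fintype.card_fin]
      rw [← inv_pow, ← mul_pow]
      field_simp
    have v2 : volume (Metric.ball (0 : Euc n) (S / b)) = ENNReal.ofReal (S ^ n) := by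
      rw [Measure.addHaar_ball_of_pos _ _ (by positivity), hκ,
        ← ENNReal.ofReal_mul (by positivity)]
      congr 1
      simp only [finrank_euclideanSpace, Fintype.card_fin]
      rw [← mul_pow]
      field_simp
    rw [v1, v2, ← ENNReal.rpow_add _ _ (by simpa using pow_pos hS0 n) (by simp), hw,
      ENNReal.rpow_one] at key
    exact key
  · intro x y
    by_cases hx : x ∈ {x : Euc n | (a / S) • x ∈ E}
    · by_cases hy : y ∈ Metric.ball (0 : Euc n) (S / b)
      · have : (a / S) • x + (ε * b / S) • y ∈ C := by
          refine hsub (Metric.mem_thickening_iff.2 ⟨_, hx, ?_⟩)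
          rw [dist_eq_norm, add_sub_cancel_left, norm_smul, Real.norm_of_nonneg h₂.le]
          rw [mem_ball_zero_iff] at hy
          calc ε * b / S * ‖y‖ < ε * b / S * (S / b) := by gcongr
            _ = ε := by field_simp
        simp [Set.indicator_of_mem hx, Set.indicator_of_mem hy, Set.indicator_of_mem this]
      · simp [Set.indicator_of_notMem hy, ENNReal.zero_rpow_of_pos h₂]
    · simp [Set.indicator_of_notMem hx, ENNReal.zero_rpow_of_pos h₁]

theorem pow_add_mul_pow_le_add_pow {a c : ℝ} (ha : 0 ≤ a) (hc : 0 ≤ c) (n : ℕ) :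
    a ^ n + n * c * a ^ (n - 1) ≤ (a + c) ^ n := by
  induction n with
  | zero => simp
  | succ n ih =>
    rcases n with _ | n
    · simp
    · simp only [Nat.add_sub_cancel] at ih ⊢
      have h0 : 0 ≤ (n + 1) * c ^ 2 * a ^ n := by positivity
      calc a ^ (n + 1 + 1) + ((n + 1 + 1 : ℕ) : ℝ) * c * a ^ (n + 1)
          ≤ (a ^ (n + 1) + ((n + 1 : ℕ) : ℝ) * c * a ^ n) * (a + c) := by
            push_cast; ring_nf; ring_nf at h0; linarith
        _ ≤ (a + c) ^ (n + 1) * (a + c) := by gcongr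
        _ = _ := by ring

/-- Sharp isoperimetric inequality in functional form. -/
theorem isoperimetric_le_integral_norm_fderiv {n : ℕ} (hn : 2 ≤ n) {v : Euc n → ℝ}
    (hv : ContDiff ℝ 1 v) (hc : HasCompactSupport v) (hv0 : ∀ x, 0 ≤ v x)
    {a b : ℝ} (ha : 0 ≤ a) (hb : 0 < b)
    (hva : ENNReal.ofReal (a ^ n) ≤ volume {x | 1 ≤ v x})
    (hκ : volume (Metric.ball (0 : Euc n) 1) = ENNReal.ofReal (b ^ n)) :
    n * b * a ^ (n - 1) ≤ ∫ x, ‖fderiv ℝ v x‖ := by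
  rcases ha.eq_or_lt with rfl | ha
  · rw [zero_pow (by omega), mul_zero]
    exact integral_nonneg fun _ => norm_nonneg _
  have hDc : Continuous (fderiv ℝ v) := hv.continuous_fderiv (by norm_num)
  have hDs : HasCompactSupport (fderiv ℝ v) := hc.fderiv ℝ
  have hDu : UniformContinuous (fderiv ℝ v) := hDs.uniformContinuous_of_continuous hDc
  set K := Metric.cthickening 1 (tsupport v) with hK
  have hKc : IsCompact K := hc.isCompact.cthickening
  have hKm : MeasurableSet K := hKc.measurableSet
  have hKf : volume K ≠ ⊤ := hKc.measure_lt_top.ne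
  have hvi : Integrable v := hv.continuous.integrable_of_hasCompactSupport hc
  have hDi : Integrable fun x => ‖fderiv ℝ v x‖ :=
    hDc.norm.integrable_of_hasCompactSupport hDs.norm
  refine le_of_forall_pos_le_add fun δ hδ => ?_
  obtain ⟨η, hη, hηδ⟩ : ∃ η > 0, η * volume.real K ≤ δ := by
    refine ⟨δ / (volume.real K + 1), by positivity, ?_⟩
    rw [div_mul_eq_mul_div, div_le_iff₀ (by positivity)]
    nlinarith [measureReal_nonneg (μ := volume) (s := K)]
  obtain ⟨ε₀, hε₀, hε₀'⟩ := Metric.uniformContinuous_iff.1 hDu η hη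
  set ε := min ε₀ 1 with hεd
  have hε : 0 < ε := by positivity
  set h : Euc n → ℝ := fun x => v x + ε * (‖fderiv ℝ v x‖ + K.indicator (fun _ => η) x) with hh
  have hKi : Integrable (K.indicator fun _ => η) :=
    (integrable_indicator_iff hKm).2 (integrableOn_const hKf)
  have hhi : Integrable h := hvi.add ((hDi.add hKi).const_mul ε)
  have hhm : Measurable h := by
    have := hv.continuous.measurable
    have := hDc.norm.measurable
    have : Measurable (K.indicator fun _ => η) := measurable_const.indicator hKm
    fun_prop
  have hh0 : ∀ x, 0 ≤ h x := fun x => by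
    have : 0 ≤ K.indicator (fun _ => η) x := Set.indicator_nonneg (fun _ _ => hη.le) x
    have := hv0 x
    positivity
  have hth : ∀ s : ℝ, 0 ≤ s → Metric.thickening ε {x | s < v x} ⊆ {x | s < h x} := by
    intro s hs x hx
    obtain ⟨y, hy, hxy⟩ := Metric.mem_thickening_iff.1 hx
    have hy : s < v y := hy
    have hxK : x ∈ K := by
      refine Metric.mem_cthickening_of_dist_le x y 1 _ ?_ (hxy.le.trans (min_le_right _ _))
      exact subset_tsupport _ (by simpa using (hs.trans_lt hy).ne')
    have mv : ‖v y - v x‖ ≤ (‖fderiv ℝ v x‖ + η) * ‖y - x‖ := by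
      refine (convex_ball x ε).norm_image_sub_le_of_norm_fderiv_le (𝕜 := ℝ)
        (fun z _ => (hv.differentiable (by norm_num)).differentiableAt) (fun z hz => ?_)
        (Metric.mem_ball_self hε) (by rwa [Metric.mem_ball, dist_comm])
      have := hε₀' ((Metric.mem_ball.1 hz).trans_le (min_le_left _ _))
      rw [dist_eq_norm] at this
      linarith [norm_le_norm_add_norm_sub (fderiv ℝ v x) (fderiv ℝ v z),
        norm_le_norm_add_norm_sub' (fderiv ℝ v z) (fderiv ℝ v x)]
    rw [dist_comm, dist_eq_norm] at hxy
    have h1 : (‖fderiv ℝ v x‖ + η) * ‖y - x‖ ≤ (‖fderiv ℝ v x‖ + η) * ε := by gcongr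
    have h2 := (le_abs_self _).trans mv
    change s < v x + ε * (‖fderiv ℝ v x‖ + K.indicator (fun _ => η) x)
    rw [Set.indicator_of_mem hxK]
    linarith
  have hopen : ∀ s : ℝ, MeasurableSet {x | s < v x} := fun s =>
    measurableSet_lt measurable_const hv.continuous.measurable
  have hlev : ∀ s ∈ Set.Ioi (0 : ℝ), volume {x | s < v x} +
      (Set.Ioo (0 : ℝ) 1).indicator (fun _ => ENNReal.ofReal (n * (ε * b) * a ^ (n - 1))) s ≤
      volume {x | s < h x} := by
    intro s (hs : 0 < s)
    by_cases hs1 : s < 1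
    · rw [Set.indicator_of_mem (Set.mem_Ioo.2 ⟨hs, hs1⟩)]
      have hfin : volume {x | s < v x} ≠ ⊤ := by
        refine ne_top_of_le_ne_top hc.isCompact.measure_lt_top.ne
          (measure_mono (t := tsupport v) fun x hx => ?_)
        exact subset_tsupport _ (by simpa using (hs.trans hx).ne')
      set a' := (volume {x | s < v x}).toReal ^ ((n : ℝ)⁻¹) with ha'
      have hpow : a' ^ n = (volume {x | s < v x}).toReal :=
        Real.rpow_inv_natCast_pow ENNReal.toReal_nonneg (by omega)
      have hvol : volume {x | s < v x} = ENNReal.ofReal (a' ^ n) := by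
        rw [hpow, ENNReal.ofReal_toReal hfin]
      have haa : a ≤ a' := by
        refine le_of_pow_le_pow_left₀ (n := n) (by omega) (by positivity) ?_
        rw [← ENNReal.ofReal_le_ofReal_iff (by positivity), ← hvol]
        exact hva.trans (measure_mono fun x (hx : 1 ≤ v x) => hs1.trans_le hx)
      have hmono : (n : ℝ) * (ε * b) * a ^ (n - 1) ≤ n * (ε * b) * a' ^ (n - 1) := by gcongr
      rw [hvol, ← ENNReal.ofReal_add (by positivity) (by positivity)]
      refine le_trans ?_ (ofReal_pow_le_volume_of_thickening_subset (hopen s)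
        (measurableSet_lt measurable_const hhm) (ha.trans_le haa) hb hε hvol hκ (hth s hs.le))
      refine ENNReal.ofReal_le_ofReal ?_
      have := pow_add_mul_pow_le_add_pow (a := a') (c := ε * b) (by positivity) (by positivity) n
      linarith
    · rw [Set.indicator_of_notMem (fun h => hs1 h.2), add_zero]
      exact measure_mono ((Metric.self_subset_thickening hε _).trans (hth s hs.le))
  have hm : ∀ φ : Euc n → ℝ, Measurable fun t : ℝ => volume {x | t < φ x} := fun φ =>
    Antitone.measurable fun s t hst => measure_mono fun x (hx : t < φ x) => lt_of_le_of_lt hst hx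
  have hint := setLIntegral_mono (μ := volume) (hm h) hlev
  rw [lintegral_add_left (hm v), ← lintegral_eq_lintegral_meas_lt _ (ae_of_all _ hv0)
    hv.continuous.measurable.aemeasurable, ← lintegral_eq_lintegral_meas_lt _ (ae_of_all _ hh0)
    hhm.aemeasurable, lintegral_indicator measurableSet_Ioo, lintegral_const,
    Measure.restrict_restrict measurableSet_Ioo, Measure.restrict_apply_univ,
    Set.inter_eq_left.2 (fun x hx => hx.1), Real.volume_Ioo, sub_zero, ENNReal.ofReal_one, mul_one,
    ← ofReal_integral_eq_lintegral_ofReal hvi (ae_of_all _ hv0),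
    ← ofReal_integral_eq_lintegral_ofReal hhi (ae_of_all _ hh0),
    ← ENNReal.ofReal_add (integral_nonneg hv0) (by positivity),
    ENNReal.ofReal_le_ofReal_iff (integral_nonneg hh0)] at hint
  have hsum : ∫ x, h x = (∫ x, v x) + ε * ((∫ x, ‖fderiv ℝ v x‖) + volume.real K * η) := by
    rw [← smul_eq_mul (volume.real K), ← integral_indicator_const _ hKm, ← integral_add hDi hKi,
      ← integral_const_mul]
    exact integral_add hvi ((hDi.add hKi).const_mul ε)
  rw [hsum] at hint
  have : ε * (n * b * a ^ (n - 1)) ≤ ε * ((∫ x, ‖fderiv ℝ v x‖) + volume.real K * η) := by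
    linarith
  have := le_of_mul_le_mul_left this hε
  linarith

/-- Integrated form of the differential inequality `-dμ/ds ≥ K μ ^ (1 + q)`. -/
theorem mul_le_rpow_neg_of_forall_le_sub {μ : ℝ → ℝ} {K q s₀ : ℝ} (hK : 0 < K) (hq : 0 < q)
    (hq1 : q ≤ 1) (hs₀ : 0 < s₀) (hpos : ∀ s, 0 ≤ s → s ≤ s₀ → 0 < μ s)
    (hanti : ∀ a b, 0 ≤ a → a ≤ b → b ≤ s₀ → μ b ≤ μ a)
    (h : ∀ a b, 0 ≤ a → a < b → b ≤ s₀ → K * (b - a) * μ b ^ (1 + q) ≤ μ a - μ b) :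
    q * K * s₀ ≤ μ s₀ ^ (-q) := by
  have hμ0 := hpos 0 le_rfl hs₀.le
  set y : ℝ → ℝ := fun s => μ s ^ (-q) with hy
  have hypos : ∀ s, 0 ≤ s → s ≤ s₀ → 0 < y s := fun s h0 h1 => Real.rpow_pos_of_pos (hpos s h0 h1) _
  have hy0 := hypos 0 le_rfl hs₀.le
  have hstep : ∀ a b, 0 ≤ a → a < b → b ≤ s₀ →
      y a ≤ y b - q * (K * (b - a)) / (1 + K * (b - a) / y 0) := by
    intro a b ha hab hb
    have hb0 : 0 ≤ b := ha.trans hab.le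
    have hμb := hpos b hb0 hb
    have hyb := hypos b hb0 hb
    have hd : 0 < K * (b - a) := mul_pos hK (sub_pos.2 hab)
    have hyy : y 0 ≤ y b :=
      Real.rpow_le_rpow_of_nonpos hμb (hanti 0 b le_rfl hb0 hb) (by linarith)
    set z := K * (b - a) / y b with hz
    have hz0 : 0 < z := by positivity
    have hμa : μ b * (1 + z) ≤ μ a := by
      have h1 := h a b ha hab hb
      have h2 : μ b * z = K * (b - a) * μ b ^ (1 + q) := by
        rw [hz, hy, Real.rpow_add hμb, Real.rpow_one]
        simp only [Real.rpow_neg hμb.le]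
        field_simp
      linarith
    have h3 : y a ≤ y b * (1 + z) ^ (-q) := by
      calc y a ≤ (μ b * (1 + z)) ^ (-q) :=
            Real.rpow_le_rpow_of_nonpos (by positivity) hμa (by linarith)
        _ = _ := Real.mul_rpow hμb.le (by positivity)
    have h4 : (1 + z) ^ (-q) ≤ 1 - q * (z / (1 + z)) := by
      have e : (1 + z) ^ (-q) = (1 + -(z / (1 + z))) ^ q := by
        rw [Real.rpow_neg (by positivity), ← Real.inv_rpow (by positivity)]
        congr 1
        field_simp
        ring
      rw [e]
      have := rpow_one_add_le_one_add_mul_self (s := -(z / (1 + z))) (p := q)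
        (by rw [neg_le_neg_iff, div_le_one (by positivity)]; linarith) hq.le hq1
      linarith
    have h5 : y b * (z / (1 + z)) = K * (b - a) / (1 + z) := by
      rw [hz]; field_simp
    have h6 : K * (b - a) / (1 + K * (b - a) / y 0) ≤ K * (b - a) / (1 + z) := by
      rw [hz]; gcongr
    calc y a ≤ y b * (1 + z) ^ (-q) := h3
      _ ≤ y b * (1 - q * (z / (1 + z))) := by gcongr
      _ = y b - q * (y b * (z / (1 + z))) := by ring
      _ ≤ y b - q * (K * (b - a) / (1 + K * (b - a) / y 0)) := by rw [h5]; gcongr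
      _ = _ := by ring
  have hN : ∀ N : ℕ, q * K * s₀ / (1 + K * s₀ / y 0 / ((N : ℝ) + 1)) ≤ y s₀ := by
    intro N
    set δ := s₀ / ((N : ℝ) + 1) with hδ
    have hδ0 : 0 < δ := by positivity
    set D := q * (K * δ) / (1 + K * δ / y 0) with hD
    have hind : ∀ k : ℕ, k ≤ N + 1 → y 0 ≤ y (k * δ) - k * D := by
      intro k
      induction k with
      | zero => intro _; simp
      | succ k ih =>
        intro hk
        have h1 := ih (by omega)
        have hkN : ((k + 1 : ℕ) : ℝ) ≤ (N : ℝ) + 1 := by exact_mod_cast hk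
        have h2 := hstep (k * δ) ((k + 1 : ℕ) * δ) (by positivity) (by push_cast; nlinarith)
          (by
            calc ((k + 1 : ℕ) : ℝ) * δ ≤ ((N : ℝ) + 1) * δ := by gcongr
              _ = s₀ := by rw [hδ]; field_simp)
        have e : ((k + 1 : ℕ) : ℝ) * δ - k * δ = δ := by push_cast; ring
        rw [e] at h2
        push_cast at h2 ⊢
        linarith
    have h1 := hind (N + 1) le_rfl
    have e1 : ((N + 1 : ℕ) : ℝ) * δ = s₀ := by rw [hδ]; push_cast; field_simp
    have e2 : ((N + 1 : ℕ) : ℝ) * D = q * K * s₀ / (1 + K * s₀ / y 0 / ((N : ℝ) + 1)) := by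
      rw [hD, hδ]; push_cast; field_simp
    rw [e1, e2] at h1
    linarith
  have hlim : Tendsto (fun N : ℕ => q * K * s₀ / (1 + K * s₀ / y 0 / ((N : ℝ) + 1))) atTop
      (𝓝 (q * K * s₀ / (1 + 0))) := by
    refine Tendsto.div tendsto_const_nhds (tendsto_const_nhds.add ?_) (by norm_num)
    exact tendsto_const_nhds.div_atTop (tendsto_natCast_atTop_atTop.atTop_add tendsto_const_nhds)
  rw [add_zero, div_one] at hlim
  exact le_of_tendsto' hlim hN

theorem lapl_eq_sum_fderiv {n : ℕ} {φ : Euc n → ℝ} (hφ : ContDiff ℝ 2 φ) (x : Euc n) :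
    lapl n φ x = ∑ i : Fin n, fderiv ℝ (fun y => fderiv ℝ φ y (EuclideanSpace.single i 1)) x
      (EuclideanSpace.single i 1) := by
  refine Finset.sum_congr rfl fun i _ => ?_
  rw [iteratedFDeriv_two_apply]
  have hd : DifferentiableAt ℝ (fderiv ℝ φ) x :=
    ((hφ.fderiv_right (m := 1) (by norm_num)).differentiable (by norm_num)).differentiableAt
  rw [fderiv_clm_apply hd (differentiableAt_const _)]
  simp

theorem continuous_lapl {n : ℕ} {φ : Euc n → ℝ} (hφ : ContDiff ℝ 2 φ) :
    Continuous (lapl n φ) := by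
  unfold lapl
  refine continuous_finsetSum _ fun i _ => ?_
  have := hφ.continuous_iteratedFDeriv (m := 2) le_rfl
  fun_prop

theorem hasCompactSupport_lapl {n : ℕ} {φ : Euc n → ℝ} (hφ : HasCompactSupport φ) :
    HasCompactSupport (lapl n φ) := by
  refine (hφ.iteratedFDeriv (𝕜 := ℝ) 2).mono (Function.support_subset_iff'.2 fun x hx => ?_)
  simp [lapl, Function.notMem_support.1 hx]

theorem norm_sq_dual_eq_sum {n : ℕ} (L : Euc n →L[ℝ] ℝ) :
    ‖L‖ ^ 2 = ∑ i : Fin n, L (EuclideanSpace.single i 1) ^ 2 := by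
  have h := EuclideanSpace.norm_sq_eq ((InnerProductSpace.toDual ℝ (Euc n)).symm L)
  rw [LinearIsometryEquiv.norm_map] at h
  rw [h]
  refine Finset.sum_congr rfl fun i _ => ?_
  rw [← InnerProductSpace.toDual_symm_apply (𝕜 := ℝ) (y := L), EuclideanSpace.inner_single_right]
  simp

/-- Integration by parts: the energy of `u` weighted by the derivative of `Φ` at `u`. -/
theorem integral_deriv_mul_norm_fderiv_sq {n : ℕ} {u : Euc n → ℝ} (hu : ContDiff ℝ 2 u)
    (hc : HasCompactSupport u) {Φ : ℝ → ℝ} (hΦ : ContDiff ℝ 1 Φ) :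
    ∫ x, deriv Φ (u x) * ‖fderiv ℝ u x‖ ^ 2 = -∫ x, Φ (u x) * lapl n u x := by
  have hΦ' : Continuous (deriv Φ) := hΦ.continuous_deriv (by norm_num)
  have hD : ContDiff ℝ 1 (fderiv ℝ u) := hu.fderiv_right (by norm_num)
  have hDi : ∀ i : Fin n, ContDiff ℝ 1 fun x => fderiv ℝ u x (EuclideanSpace.single i 1) :=
    fun i => hD.clm_apply contDiff_const
  have hDs : ∀ i : Fin n, HasCompactSupport fun x => fderiv ℝ u x (EuclideanSpace.single i 1) :=
    fun i => (hc.fderiv ℝ).comp_left (g := fun L : Euc n →L[ℝ] ℝ => L (EuclideanSpace.single i 1))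
      (by simp)
  have hDDc : ∀ i : Fin n, Continuous fun x => fderiv ℝ (fun y =>
      fderiv ℝ u y (EuclideanSpace.single i 1)) x (EuclideanSpace.single i 1) :=
    fun i => ((hDi i).continuous_fderiv (by norm_num)).clm_apply continuous_const
  have hDDs : ∀ i : Fin n, HasCompactSupport fun x => fderiv ℝ (fun y =>
      fderiv ℝ u y (EuclideanSpace.single i 1)) x (EuclideanSpace.single i 1) :=
    fun i => ((hDs i).fderiv ℝ).comp_left
      (g := fun L : Euc n →L[ℝ] ℝ => L (EuclideanSpace.single i 1)) (by simp)
  have hΦu : ContDiff ℝ 1 fun x => Φ (u x) := hΦ.comp (hu.of_le (by norm_num))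
  have hfd : ∀ x v, fderiv ℝ (fun x => Φ (u x)) x v = deriv Φ (u x) * fderiv ℝ u x v := by
    intro x v
    have h1 := ((hΦ.differentiable (by norm_num)).differentiableAt (x := u x)).hasDerivAt
    have h2 := ((hu.differentiable (by norm_num)).differentiableAt (x := x)).hasFDerivAt
    have h3 : HasFDerivAt (fun x => Φ (u x)) (deriv Φ (u x) • fderiv ℝ u x) x :=
      h1.comp_hasFDerivAt x h2
    rw [h3.fderiv]
    simp
  have huc := hu.continuous
  have hi1 : ∀ i : Fin n, Integrable fun x => Φ (u x) * fderiv ℝ (fun y =>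
      fderiv ℝ u y (EuclideanSpace.single i 1)) x (EuclideanSpace.single i 1) := fun i =>
    (hΦu.continuous.mul (hDDc i)).integrable_of_hasCompactSupport (hDDs i).mul_left
  have hi2 : ∀ i : Fin n, Integrable fun x =>
      deriv Φ (u x) * fderiv ℝ u x (EuclideanSpace.single i 1) ^ 2 := fun i => by
    have := (hDi i).continuous
    refine Continuous.integrable_of_hasCompactSupport (by fun_prop) ?_
    simp only [pow_two]
    exact ((hDs i).mul_left).mul_left
  have hibp : ∀ i : Fin n, ∫ x, Φ (u x) * fderiv ℝ (fun y =>
      fderiv ℝ u y (EuclideanSpace.single i 1)) x (EuclideanSpace.single i 1) =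
      -∫ x, deriv Φ (u x) * fderiv ℝ u x (EuclideanSpace.single i 1) ^ 2 := by
    intro i
    rw [integral_mul_fderiv_eq_neg_fderiv_mul_of_integrable (f := fun x => Φ (u x))
      (g := fun y => fderiv ℝ u y (EuclideanSpace.single i 1)) ?_ (hi1 i) ?_ ?_ ?_]
    · congr 1
      refine integral_congr_ae (ae_of_all _ fun x => ?_)
      simp only [hfd]; ring
    · refine (hi2 i).congr (ae_of_all _ fun x => ?_)
      simp only [hfd]; ring
    · exact (hΦu.continuous.mul (hDi i).continuous).integrable_of_hasCompactSupport (hDs i).mul_left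
    · exact fun x _ => (hΦu.differentiable (by norm_num)).differentiableAt
    · exact fun x _ => ((hDi i).differentiable (by norm_num)).differentiableAt
  simp only [norm_sq_dual_eq_sum, lapl_eq_sum_fderiv hu, Finset.mul_sum]
  rw [integral_finsetSum _ fun i _ => hi2 i, integral_finsetSum _ fun i _ => hi1 i,
    ← Finset.sum_neg_distrib]
  exact Finset.sum_congr rfl fun i _ => by rw [hibp i, neg_neg]

theorem integral_lapl_eq_zero {n : ℕ} {u : Euc n → ℝ} (hu : ContDiff ℝ 2 u)
    (hc : HasCompactSupport u) : ∫ x, lapl n u x = 0 := by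
  have := integral_deriv_mul_norm_fderiv_sq hu hc (Φ := fun _ => 1) contDiff_const
  simpa using this.symm

theorem integral_deriv_mul_norm_fderiv_sq_le {n : ℕ} {u : Euc n → ℝ} (hu : ContDiff ℝ 2 u)
    (hc : HasCompactSupport u) {Φ : ℝ → ℝ} (hΦ : ContDiff ℝ 1 Φ) {M : ℝ}
    (h0 : ∀ s, 0 ≤ Φ s) (hM : ∀ s, Φ s ≤ M) :
    ∫ x, deriv Φ (u x) * ‖fderiv ℝ u x‖ ^ 2 ≤ M / 2 * ∫ x, |lapl n u x| := by
  have hlc := continuous_lapl hu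
  have hls := hasCompactSupport_lapl hc
  have hi : Integrable (lapl n u) := hlc.integrable_of_hasCompactSupport hls
  have hi2 : Integrable fun x => Φ (u x) * lapl n u x :=
    ((hΦ.continuous.comp hu.continuous).mul hlc).integrable_of_hasCompactSupport hls.mul_left
  rw [integral_deriv_mul_norm_fderiv_sq hu hc hΦ]
  have e : -∫ x, Φ (u x) * lapl n u x = ∫ x, (M / 2 * lapl n u x - Φ (u x) * lapl n u x) := by
    rw [integral_sub (hi.const_mul _) hi2, integral_const_mul, integral_lapl_eq_zero hu hc]
    ring
  rw [e, ← integral_const_mul]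
  refine integral_mono ((hi.const_mul _).sub hi2) (hi.abs.const_mul _) fun x => ?_
  calc M / 2 * lapl n u x - Φ (u x) * lapl n u x = (M / 2 - Φ (u x)) * lapl n u x := by ring
    _ ≤ |(M / 2 - Φ (u x)) * lapl n u x| := le_abs_self _
    _ = |M / 2 - Φ (u x)| * |lapl n u x| := abs_mul _ _
    _ ≤ M / 2 * |lapl n u x| := by
      gcongr
      rw [abs_le]
      constructor <;> linarith [h0 (u x), hM (u x)]

/-- A `C¹` nondecreasing function that is constant off `(a, b)` and whose slope lies in `[0, 1]`. -/
theorem exists_contDiff_ramp {a b θ : ℝ} (hab : a < b) (hθ0 : 0 < θ) (hθ1 : θ < 1) :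
    ∃ (Φ : ℝ → ℝ) (M : ℝ), ContDiff ℝ 1 Φ ∧ θ * (b - a) ≤ M ∧ (∀ s, 0 ≤ Φ s) ∧ (∀ s, Φ s ≤ M) ∧
      (∀ s, s ≤ a → Φ s = 0) ∧ (∀ s, b ≤ s → Φ s = M) ∧
      (∀ s, 0 ≤ deriv Φ s) ∧ (∀ s, deriv Φ s ≤ 1) ∧ ∀ s, s ∉ Set.Ioo a b → deriv Φ s = 0 := by
  have hd : 0 < b - a := sub_pos.2 hab
  let g : ContDiffBump ((a + b) / 2) :=
    ⟨θ * ((b - a) / 2), (b - a) / 2, by positivity, by nlinarith⟩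
  have hgc : Continuous g := g.continuous
  have hsupp : Function.support g = Set.Ioo a b := by
    rw [g.support_eq, Real.ball_eq_Ioo]
    congr 1 <;> simp only [g] <;> ring
  have hgz : ∀ s, s ∉ Set.Ioo a b → g s = 0 := fun s hs => by
    rwa [← hsupp, Function.notMem_support] at hs
  set Φ : ℝ → ℝ := fun s => ∫ τ in a..s, g τ with hΦ
  have hder : ∀ s, HasDerivAt Φ (g s) s := fun s => hgc.integral_hasStrictDerivAt a s |>.hasDerivAt
  have hderiv : deriv Φ = g := funext fun s => (hder s).deriv
  have hC1 : ContDiff ℝ 1 Φ := by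
    rw [contDiff_one_iff_deriv, hderiv]
    exact ⟨fun s => (hder s).differentiableAt, hgc⟩
  have hmono : Monotone Φ := monotone_of_deriv_nonneg (fun s => (hder s).differentiableAt)
    fun s => by rw [hderiv]; exact g.nonneg
  have hlow : ∀ s, s ≤ a → Φ s = 0 := by
    intro s hs
    refine (intervalIntegral.integral_congr (g := fun _ => (0 : ℝ)) fun τ hτ => ?_).trans (by simp)
    rw [Set.uIcc_of_ge hs] at hτ
    exact hgz τ fun h => absurd h.1 (not_lt.2 hτ.2)
  have hhigh : ∀ s, b ≤ s → Φ s = ∫ τ, g τ := fun s hs =>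
    intervalIntegral.integral_eq_integral_of_support_subset
      (by rw [hsupp]; exact fun τ hτ => ⟨hτ.1, hτ.2.le.trans hs⟩)
  refine ⟨Φ, ∫ τ, g τ, hC1, ?_, fun s => ?_, fun s => ?_, hlow, hhigh, fun s => ?_, fun s => ?_,
    fun s hs => ?_⟩
  · refine le_trans (le_of_eq ?_) (g.measure_closedBall_le_integral volume)
    rw [Measure.real, Real.volume_closedBall, ENNReal.toReal_ofReal] <;> simp only [g]
    · ring
    · positivity
  · rw [← hlow (min s a) (min_le_right _ _)]
    exact hmono (min_le_left _ _)
  · rw [← hhigh (max s b) (le_max_right _ _)]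
    exact hmono (le_max_left _ _)
  · rw [hderiv]; exact g.nonneg
  · rw [hderiv]; exact g.le_one
  · rw [hderiv]; exact hgz s hs

theorem volume_superlevel_ne_top {n : ℕ} {u : Euc n → ℝ} (hc : HasCompactSupport u) {a : ℝ}
    (ha : 0 ≤ a) : volume {x | a < u x} ≠ ⊤ := by
  refine ne_top_of_le_ne_top hc.isCompact.measure_lt_top.ne
    (measure_mono (t := tsupport u) fun x hx => ?_)
  exact subset_tsupport _ (by simpa using (ha.trans_lt hx).ne')

theorem isoperimetric_sq_mul_le {n : ℕ} (hn : 2 ≤ n) {u : Euc n → ℝ} (hu : ContDiff ℝ 2 u)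
    (hc : HasCompactSupport u) {a b A κ : ℝ} (ha : 0 ≤ a) (hab : a < b) (hA : 0 ≤ A) (hκ : 0 < κ)
    (hvA : ENNReal.ofReal (A ^ n) ≤ volume {x | b ≤ u x})
    (hκv : volume (Metric.ball (0 : Euc n) 1) = ENNReal.ofReal (κ ^ n)) :
    (n * κ * A ^ (n - 1)) ^ 2 * (b - a) ≤
      (∫ x, |lapl n u x|) / 2 * volume.real {x | a < u x ∧ u x < b} := by
  set S := {x | a < u x ∧ u x < b} with hS
  have hSm : MeasurableSet S :=
    (measurableSet_lt measurable_const hu.continuous.measurable).inter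
      (measurableSet_lt hu.continuous.measurable measurable_const)
  have hSf : volume S ≠ ⊤ := ne_top_of_le_ne_top (volume_superlevel_ne_top hc ha)
    (measure_mono fun x hx => hx.1)
  set L := ∫ x, |lapl n u x| with hL
  set I := n * κ * A ^ (n - 1) with hI
  have hL0 : 0 ≤ L := integral_nonneg fun _ => abs_nonneg _
  have hd : 0 < b - a := sub_pos.2 hab
  have hθ : ∀ θ : ℝ, 0 < θ → θ < 1 → θ * (I ^ 2 * (b - a)) ≤ L / 2 * volume.real S := by
    intro θ hθ0 hθ1
    obtain ⟨Φ, M, hΦ, hM, hΦ0, hΦM, hlow, hhigh, hd0, hd1, hdS⟩ :=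
      exists_contDiff_ramp hab hθ0 hθ1
    have hMpos : 0 < M := (mul_pos hθ0 hd).trans_le hM
    have hΦu : ContDiff ℝ 1 fun x => Φ (u x) / M := (hΦ.comp (hu.of_le (by norm_num))).div_const M
    have hΦus : HasCompactSupport fun x => Φ (u x) / M :=
      hc.comp_left (g := fun s => Φ s / M) (by simp [hlow 0 ha])
    have hiso := isoperimetric_le_integral_norm_fderiv hn hΦu hΦus
      (fun x => div_nonneg (hΦ0 _) hMpos.le) hA hκ (hvA.trans (measure_mono fun x hx => by
        change 1 ≤ Φ (u x) / M
        rw [hhigh _ hx, div_self hMpos.ne'])) hκv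
    have hfd : ∀ x, fderiv ℝ (fun x => Φ (u x) / M) x = (deriv Φ (u x) / M) • fderiv ℝ u x := by
      intro x
      have h1 := ((hΦ.differentiable (by norm_num)).differentiableAt (x := u x)).hasDerivAt
      have h2 := ((hu.differentiable (by norm_num)).differentiableAt (x := x)).hasFDerivAt
      exact HasFDerivAt.fderiv ((h1.div_const M).comp_hasFDerivAt x h2)
    have hX : ∫ x, ‖fderiv ℝ (fun x => Φ (u x) / M) x‖ =
        (∫ x, deriv Φ (u x) * ‖fderiv ℝ u x‖) / M := by
      rw [← integral_div]
      refine integral_congr_ae (ae_of_all _ fun x => ?_)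
      simp only [hfd, norm_smul, Real.norm_of_nonneg (div_nonneg (hd0 (u x)) hMpos.le)]
      ring
    rw [hX, le_div_iff₀ hMpos] at hiso
    set X := ∫ x, deriv Φ (u x) * ‖fderiv ℝ u x‖ with hXd
    have hΦ'c : Continuous fun x => deriv Φ (u x) :=
      (hΦ.continuous_deriv (by norm_num)).comp hu.continuous
    have hDc : Continuous fun x => ‖fderiv ℝ u x‖ := (hu.continuous_fderiv (by norm_num)).norm
    have hDs : HasCompactSupport fun x => ‖fderiv ℝ u x‖ := (hc.fderiv ℝ).norm
    have hi1 : Integrable fun x => deriv Φ (u x) * ‖fderiv ℝ u x‖ :=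
      (hΦ'c.mul hDc).integrable_of_hasCompactSupport hDs.mul_left
    have hi2 : Integrable fun x => deriv Φ (u x) * ‖fderiv ℝ u x‖ ^ 2 := by
      refine (hΦ'c.mul (hDc.pow 2)).integrable_of_hasCompactSupport ?_
      simp only [pow_two]
      exact hDs.mul_left.mul_left
    have hi3 : Integrable fun x => deriv Φ (u x) :=
      hΦ'c.integrable_of_hasCompactSupport
        (hc.comp_left (g := deriv Φ) (hdS 0 fun h => absurd h.1 (not_lt.2 ha)))
    set P := ∫ x, deriv Φ (u x) * ‖fderiv ℝ u x‖ ^ 2 with hP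
    set Q := ∫ x, deriv Φ (u x) with hQ
    have hPle : P ≤ M / 2 * L := integral_deriv_mul_norm_fderiv_sq_le hu hc hΦ hΦ0 hΦM
    have hQ0 : 0 ≤ Q := integral_nonneg fun x => hd0 _
    have hQle : Q ≤ volume.real S := by
      have : volume.real S = ∫ x, S.indicator (fun _ => (1 : ℝ)) x := by
        rw [integral_indicator_const _ hSm]; simp
      rw [this]
      refine integral_mono hi3 ((integrable_indicator_iff hSm).2 (integrableOn_const hSf))
        fun x => ?_
      by_cases hx : x ∈ S
      · simpa [Set.indicator_of_mem hx] using hd1 (u x)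
      · simpa [Set.indicator_of_notMem hx] using (hdS (u x) hx).le
    have hdisc : discrim P (-2 * X) Q ≤ 0 := by
      refine discrim_le_zero fun τ => ?_
      have : P * (τ * τ) + -2 * X * τ + Q =
          ∫ x, deriv Φ (u x) * (τ * ‖fderiv ℝ u x‖ - 1) ^ 2 := by
        have e : ∀ x, deriv Φ (u x) * (τ * ‖fderiv ℝ u x‖ - 1) ^ 2 =
            (τ * τ) * (deriv Φ (u x) * ‖fderiv ℝ u x‖ ^ 2) +
            (-2 * τ) * (deriv Φ (u x) * ‖fderiv ℝ u x‖) + deriv Φ (u x) := fun x => by ring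
        simp only [e]
        have h12 : Integrable fun x => (τ * τ) * (deriv Φ (u x) * ‖fderiv ℝ u x‖ ^ 2) +
            (-2 * τ) * (deriv Φ (u x) * ‖fderiv ℝ u x‖) := (hi2.const_mul _).add (hi1.const_mul _)
        rw [integral_add h12 hi3, integral_add (hi2.const_mul _) (hi1.const_mul _),
          integral_const_mul, integral_const_mul]
        ring
      rw [this]
      exact integral_nonneg fun x => mul_nonneg (hd0 _) (sq_nonneg _)
    have hXPQ : X ^ 2 ≤ P * Q := by
      unfold discrim at hdisc; nlinarith
    have hI0 : 0 ≤ I := by positivity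
    have h1 : (I * M) ^ 2 ≤ M / 2 * L * volume.real S := by
      calc (I * M) ^ 2 ≤ X ^ 2 := by gcongr
        _ ≤ P * Q := hXPQ
        _ ≤ M / 2 * L * volume.real S := by gcongr
    have h2 : M * (I ^ 2 * M) ≤ M * (L / 2 * volume.real S) := by nlinarith
    have h3 := le_of_mul_le_mul_left h2 hMpos
    calc θ * (I ^ 2 * (b - a)) = I ^ 2 * (θ * (b - a)) := by ring
      _ ≤ I ^ 2 * M := by gcongr
      _ ≤ _ := h3
  refine le_of_tendsto (x := 𝓝[<] (1 : ℝ)) (f := fun θ : ℝ => θ * (I ^ 2 * (b - a))) ?_ ?_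
  · have : Tendsto (fun θ : ℝ => θ * (I ^ 2 * (b - a))) (𝓝 1) (𝓝 (1 * (I ^ 2 * (b - a)))) :=
      tendsto_id.mul_const _
    rw [one_mul] at this
    exact this.mono_left nhdsWithin_le_nhds
  · filter_upwards [Ioo_mem_nhdsLT (show (0 : ℝ) < 1 by norm_num)] with θ h
    exact hθ θ h.1 h.2

/-- The sharp weak-type bound for test functions, up to evaluating the constants. -/
theorem level_le_of_volume_pos {n : ℕ} (hn : 3 ≤ n) {u : Euc n → ℝ} (hu : ContDiff ℝ 2 u)
    (hc : HasCompactSupport u) {s κ : ℝ} (hs : 0 < s) (hκ : 0 < κ)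
    (hκv : volume (Metric.ball (0 : Euc n) 1) = ENNReal.ofReal (κ ^ n))
    (hpos : 0 < volume.real {x | s < u x}) :
    n * (n - 2) * κ ^ 2 * s ≤ (∫ x, |lapl n u x|) / 2 *
      volume.real {x | s < u x} ^ (-(((n : ℝ) - 2) / n)) := by
  set L := ∫ x, |lapl n u x| with hL
  set μ : ℝ → ℝ := fun a => volume.real {x | a < u x} with hμ
  have hn0 : (0 : ℝ) < n := by positivity
  have hn3 : (3 : ℝ) ≤ n := by exact_mod_cast hn
  have hmeas : ∀ a, MeasurableSet {x | a < u x} := fun a =>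
    measurableSet_lt measurable_const hu.continuous.measurable
  have hanti : ∀ a b, 0 ≤ a → a ≤ b → μ b ≤ μ a := fun a b ha hab =>
    measureReal_mono (fun x hx => lt_of_le_of_lt hab hx) (volume_superlevel_ne_top hc ha)
  have hexp : ∀ m : ℝ, 0 < m →
      (m ^ ((n : ℝ)⁻¹)) ^ (n - 1) * (m ^ ((n : ℝ)⁻¹)) ^ (n - 1) =
        m ^ (1 + ((n : ℝ) - 2) / n) := by
    intro m hm
    rw [← Real.rpow_natCast, ← Real.rpow_mul hm.le, ← Real.rpow_add hm]
    congr 1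
    rw [Nat.cast_sub (by omega)]
    field_simp
    push_cast
    ring
  have hstep : ∀ a b, 0 ≤ a → a < b → b ≤ s →
      (n * κ) ^ 2 * (b - a) * μ b ^ (1 + ((n : ℝ) - 2) / n) ≤ L / 2 * (μ a - μ b) := by
    intro a b ha hab hb
    have hb0 : 0 ≤ b := ha.trans hab.le
    have hμb : 0 < μ b := hpos.trans_le (hanti b s hb0 hb)
    have h1 := isoperimetric_sq_mul_le (n := n) (by omega) hu hc ha hab
      (A := μ b ^ ((n : ℝ)⁻¹)) (by positivity) hκ ?_ hκv
    · have h2 : volume.real {x | a < u x ∧ u x < b} ≤ μ a - μ b := by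
        have hdis : Disjoint {x | a < u x ∧ u x < b} {x | b < u x} :=
          Set.disjoint_left.2 fun x hx hx' => absurd (hx.2.trans hx') (lt_irrefl _)
        have := measureReal_union (μ := volume) hdis (hmeas b)
          (ne_top_of_le_ne_top (volume_superlevel_ne_top hc ha) (measure_mono fun x hx => hx.1))
          (volume_superlevel_ne_top hc hb0)
        have hle : volume.real ({x | a < u x ∧ u x < b} ∪ {x | b < u x}) ≤ μ a :=
          measureReal_mono (by
            rintro x (hx | hx)
            · exact hx.1
            · exact hab.trans hx) (volume_superlevel_ne_top hc ha)
        simp only [hμ] at hle ⊢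
        linarith
      calc (n * κ) ^ 2 * (b - a) * μ b ^ (1 + ((n : ℝ) - 2) / n)
          = (n * κ * (μ b ^ ((n : ℝ)⁻¹)) ^ (n - 1)) ^ 2 * (b - a) := by
            rw [← hexp _ hμb]; ring
        _ ≤ L / 2 * volume.real {x | a < u x ∧ u x < b} := h1
        _ ≤ _ := by
            have : 0 ≤ L := integral_nonneg fun _ => abs_nonneg _
            gcongr
    · rw [Real.rpow_inv_natCast_pow hμb.le (by omega)]
      simp only [hμ, measureReal_def, ENNReal.ofReal_toReal (volume_superlevel_ne_top hc hb0)]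
      exact measure_mono fun x (hx : b < u x) => hx.le
  have hL0 : 0 < L := by
    refine lt_of_le_of_ne (integral_nonneg fun _ => abs_nonneg _) fun h => ?_
    have h1 := hstep 0 s le_rfl hs le_rfl
    rw [← h, zero_div, zero_mul] at h1
    have : 0 < (n * κ) ^ 2 * (s - 0) * μ s ^ (1 + ((n : ℝ) - 2) / n) := by
      have : 0 < μ s := hpos
      rw [sub_zero]; positivity
    linarith
  have key := mul_le_rpow_neg_of_forall_le_sub (μ := μ) (K := (n * κ) ^ 2 / (L / 2))
    (q := ((n : ℝ) - 2) / n) (s₀ := s) (by positivity) (div_pos (by linarith) hn0)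
    ((div_le_one hn0).2 (by linarith)) hs
    (fun a ha has => hpos.trans_le (hanti a s ha has))
    (fun a b ha hab _ => hanti a b ha hab)
    (fun a b ha hab hb => by
      have := hstep a b ha hab hb
      rw [div_mul_eq_mul_div, div_mul_eq_mul_div, div_le_iff₀ (by positivity)]
      linarith)
  calc n * (n - 2) * κ ^ 2 * s
      = L / 2 * (((n : ℝ) - 2) / n * ((n * κ) ^ 2 / (L / 2)) * s) := by field_simp
    _ ≤ _ := by gcongr

theorem omegaS_pos {n : ℕ} (hn : 0 < n) : 0 < omegaS n := by
  unfold omegaS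
  have : 0 < Real.Gamma ((n : ℝ) / 2) := Real.Gamma_pos_of_pos (by positivity)
  positivity

theorem volume_unit_ball_eq_omegaS_div {n : ℕ} (hn : 0 < n) :
    volume (Metric.ball (0 : Euc n) 1) = ENNReal.ofReal (omegaS n / n) := by
  have : Nonempty (Fin n) := ⟨⟨0, hn⟩⟩
  rw [EuclideanSpace.volume_ball]
  have hn' : (n : ℝ) / 2 ≠ 0 := by positivity
  have hG : 0 < Real.Gamma ((n : ℝ) / 2) := Real.Gamma_pos_of_pos (by positivity)
  rw [Fintype.card_fin, ENNReal.ofReal_one, one_pow, one_mul, Real.Gamma_add_one hn', omegaS,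
    Real.sqrt_eq_rpow, ← Real.rpow_natCast, ← Real.rpow_mul Real.pi_pos.le]
  congr 1
  rw [one_div_mul_eq_div]
  field_simp

/-- The radius scale `κ` for which balls of radius `r` have volume `(κ r) ^ n`. -/
theorem exists_ball_scale {n : ℕ} (hn : 0 < n) :
    ∃ κ : ℝ, 0 < κ ∧ κ ^ n = omegaS n / n ∧
      volume (Metric.ball (0 : Euc n) 1) = ENNReal.ofReal (κ ^ n) := by
  have h0 : 0 < omegaS n / n := div_pos (omegaS_pos hn) (by positivity)
  have h1 : ((omegaS n / n) ^ ((n : ℝ)⁻¹)) ^ n = omegaS n / n :=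
    Real.rpow_inv_natCast_pow h0.le hn.ne'
  exact ⟨_, by positivity, h1, by rw [h1, volume_unit_ball_eq_omegaS_div hn]⟩

theorem NstarInf_eq {n : ℕ} (hn : 3 ≤ n) {κ : ℝ} (hκ : 0 < κ) (hκn : κ ^ n = omegaS n / n)
    (t : ℝ) : NstarInf n t = (n * (n - 2) * κ ^ 2)⁻¹ * t ^ (-(((n : ℝ) - 2) / n)) := by
  have hn0 : (0 : ℝ) < n := by positivity
  have hn3 : (3 : ℝ) ≤ n := by exact_mod_cast hn
  have hω : omegaS n = n * κ ^ n := by rw [hκn]; field_simp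
  have h1 : (κ ^ n : ℝ) ^ (((n : ℝ) - 2) / n) = κ ^ (n - 2) := by
    rw [← Real.rpow_natCast, ← Real.rpow_mul hκ.le, ← Real.rpow_natCast]
    congr 1
    rw [Nat.cast_sub (by omega)]
    field_simp
    norm_num
  have h2 : κ ^ n = κ ^ (n - 2) * κ ^ 2 := by rw [← pow_add]; congr 1; omega
  unfold NstarInf cConst
  rw [← hκn, h1, hω, h2]
  have : (n : ℝ) - 2 ≠ 0 := by linarith
  field_simp

theorem two_rpow_mul_NstarInf {n : ℕ} (hn : 3 ≤ n) {t : ℝ} (ht : 0 < t) :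
    (2 : ℝ) ^ (-(2 / (n : ℝ))) * NstarInf n t = NstarInf n (t / 2) / 2 := by
  have hn0 : (0 : ℝ) < n := by positivity
  unfold NstarInf
  rw [Real.div_rpow ht.le (by norm_num), Real.rpow_neg (by norm_num : (0 : ℝ) ≤ 2) (((n : ℝ) - 2) / n)]
  have : (2 : ℝ) ^ (-(2 / (n : ℝ))) = (2 : ℝ) ^ (((n : ℝ) - 2) / n) / 2 := by
    rw [eq_div_iff two_ne_zero]
    have h1 := Real.rpow_add two_pos (-(2 / (n : ℝ))) 1
    rw [Real.rpow_one] at h1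
    rw [← h1]
    congr 1
    field_simp
    ring
  rw [this]
  field_simp

theorem lapl_neg {n : ℕ} (u : Euc n → ℝ) (x : Euc n) : lapl n (-u) x = -lapl n u x := by
  simp [lapl, iteratedFDeriv_neg]

theorem NstarInf_nonneg {n : ℕ} (hn : 3 ≤ n) {t : ℝ} (ht : 0 ≤ t) : 0 ≤ NstarInf n t := by
  obtain ⟨κ, hκ, hκn, -⟩ := exists_ball_scale (n := n) (by omega)
  have hn3 : (3 : ℝ) ≤ n := by exact_mod_cast hn
  rw [NstarInf_eq hn hκ hκn]
  have : (0 : ℝ) ≤ n - 2 := by linarith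
  positivity

theorem level_le_of_lt_volume {n : ℕ} (hn : 3 ≤ n) {u : Euc n → ℝ} (hu : ContDiff ℝ 2 u)
    (hc : HasCompactSupport u) {s t : ℝ} (hs : 0 < s) (ht : 0 < t)
    (h : ENNReal.ofReal t < volume {x | s < u x}) :
    s ≤ NstarInf n t / 2 * ∫ x, |lapl n u x| := by
  obtain ⟨κ, hκ, hκn, hκv⟩ := exists_ball_scale (n := n) (by omega)
  have hn3 : (3 : ℝ) ≤ n := by exact_mod_cast hn
  have hn2 : (0 : ℝ) < n - 2 := by linarith
  have htv : t < volume.real {x | s < u x} :=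
    (ENNReal.ofReal_lt_iff_lt_toReal ht.le (volume_superlevel_ne_top hc hs.le)).1 h
  have h1 := level_le_of_volume_pos hn hu hc hs hκ hκv (ht.trans htv)
  have h2 : volume.real {x | s < u x} ^ (-(((n : ℝ) - 2) / n)) ≤ t ^ (-(((n : ℝ) - 2) / n)) :=
    Real.rpow_le_rpow_of_nonpos ht htv.le (by rw [neg_nonpos]; positivity)
  have hL : 0 ≤ ∫ x, |lapl n u x| := integral_nonneg fun _ => abs_nonneg _
  have hK : 0 < n * ((n : ℝ) - 2) * κ ^ 2 := by positivity
  rw [NstarInf_eq hn hκ hκn]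
  have h3 : n * ((n : ℝ) - 2) * κ ^ 2 * s ≤
      (∫ x, |lapl n u x|) / 2 * t ^ (-(((n : ℝ) - 2) / n)) := h1.trans (by gcongr)
  rw [mul_comm, ← le_div_iff₀ hK] at h3
  refine h3.trans (le_of_eq ?_)
  field_simp

theorem level_le_of_lt_volume_abs {n : ℕ} (hn : 3 ≤ n) {u : Euc n → ℝ} (hu : ContDiff ℝ 2 u)
    (hc : HasCompactSupport u) {s t : ℝ} (hs : 0 < s) (ht : 0 < t)
    (h : ENNReal.ofReal t < volume {x | s < |u x|}) :
    s ≤ (2 : ℝ) ^ (-(2 / (n : ℝ))) * NstarInf n t * ∫ x, |lapl n u x| := by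
  rw [two_rpow_mul_NstarInf hn ht]
  by_cases h1 : ENNReal.ofReal (t / 2) < volume {x | s < u x}
  · exact level_le_of_lt_volume hn hu hc hs (by positivity) h1
  by_cases h2 : ENNReal.ofReal (t / 2) < volume {x | s < (-u) x}
  · have := level_le_of_lt_volume hn hu.neg (hc.neg) hs (by positivity) h2
    have e : ∀ x, |lapl n (fun y => -u y) x| = |lapl n u x| := fun x => by
      rw [← abs_neg (lapl n u x), ← lapl_neg]; rfl
    simpa only [e] using this
  exfalso
  have h3 : {x | s < |u x|} = {x | s < u x} ∪ {x | s < (-u) x} := by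
    ext x; exact lt_abs (a := s) (b := u x)
  rw [h3] at h
  refine absurd (h.trans_le ((measure_union_le _ _).trans
    (add_le_add (not_lt.1 h1) (not_lt.1 h2)))) ?_
  rw [← ENNReal.ofReal_add (by positivity) (by positivity), add_halves]
  exact lt_irrefl _

theorem le_decRearr_of_lt_volume {n : ℕ} {u : Euc n → ℝ} {s t : ℝ}
    (hb : ∃ M, ∀ x, |u x| ≤ M) (h : ENNReal.ofReal t < volume {x | s < |u x|}) :
    s ≤ decRearr n Set.univ u t := by
  obtain ⟨M, hM⟩ := hb
  refine le_csInf ⟨max M 0, le_max_right _ _, ?_⟩ fun a ha => ?_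
  · have : {x | x ∈ (Set.univ : Set (Euc n)) ∧ max M 0 < |u x|} = ∅ :=
      Set.eq_empty_of_forall_notMem fun x hx =>
        absurd (hx.2.trans_le (hM x)) (not_lt.2 (le_max_left _ _))
    rw [this]; simp
  · by_contra! has
    refine absurd (h.trans_le (measure_mono fun x hx => ?_)) (not_lt.2 ha.2)
    exact ⟨Set.mem_univ x, lt_trans has hx⟩

theorem lt_volume_of_lt_decRearr {n : ℕ} {u : Euc n → ℝ} {s t : ℝ} (hs : 0 ≤ s)
    (h : s < decRearr n Set.univ u t) : ENNReal.ofReal t < volume {x | s < |u x|} := by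
  by_contra! hle
  refine absurd (csInf_le ⟨0, fun a ha => ha.1⟩ (show s ∈ {s : ℝ | 0 ≤ s ∧
    volume {x ∈ (Set.univ : Set (Euc n)) | s < |u x|} ≤ ENNReal.ofReal t} from ⟨hs, ?_⟩))
    (not_le.2 h)
  simpa using hle

theorem decRearr_le {n : ℕ} (hn : 3 ≤ n) {u f : Euc n → ℝ} (hu : MemW21Delta0 n Set.univ u f)
    {t : ℝ} (ht : 0 < t) :
    decRearr n Set.univ u t ≤
      (2 : ℝ) ^ (-(2 / (n : ℝ))) * NstarInf n t * L1norm n Set.univ f := by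
  obtain ⟨hui, hfi, φ, hφ, hφu, hφf⟩ := hu
  simp only [L1norm, Measure.restrict_univ, integrableOn_univ] at *
  have hC : 0 ≤ (2 : ℝ) ^ (-(2 / (n : ℝ))) * NstarInf n t :=
    mul_nonneg (by positivity) (NstarInf_nonneg hn ht.le)
  set C := (2 : ℝ) ^ (-(2 / (n : ℝ))) * NstarInf n t
  have hφ2 : ∀ k, ContDiff ℝ 2 (φ k) := fun k => contDiff_infty.1 (hφ k).1 2
  have hφi : ∀ k, Integrable (φ k) := fun k =>
    (hφ2 k).continuous.integrable_of_hasCompactSupport (hφ k).2.1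
  have hli : ∀ k, Integrable (lapl n (φ k)) := fun k =>
    (continuous_lapl (hφ2 k)).integrable_of_hasCompactSupport (hasCompactSupport_lapl (hφ k).2.1)
  have hlim : Tendsto (fun k => ∫ x, |lapl n (φ k) x|) atTop (𝓝 (∫ x, |f x|)) := by
    rw [tendsto_iff_norm_sub_tendsto_zero]
    refine squeeze_zero (fun _ => norm_nonneg _) (fun k => ?_) hφf
    rw [← integral_sub (hli k).abs hfi.abs]
    refine (norm_integral_le_integral_norm _).trans (integral_mono_of_nonneg
      (ae_of_all _ fun _ => norm_nonneg _) ((hli k).sub hfi).abs (ae_of_all _ fun x => ?_))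
    exact abs_abs_sub_abs_le _ _
  have hmeas : TendstoInMeasure volume φ atTop u := by
    refine tendstoInMeasure_of_tendsto_eLpNorm one_ne_zero
      (fun k => (hφi k).aestronglyMeasurable) hui.aestronglyMeasurable ?_
    have : ∀ k, eLpNorm (φ k - u) 1 volume = ENNReal.ofReal (∫ x, |φ k x - u x|) := fun k => by
      rw [eLpNorm_one_eq_lintegral_enorm, ← ofReal_integral_norm_eq_lintegral_enorm
        ((hφi k).sub hui)]
      rfl
    simp only [this]
    simpa using ENNReal.tendsto_ofReal hφu
  obtain ⟨ns, hns, hae⟩ := hmeas.exists_seq_tendsto_ae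
  refine le_of_forall_lt_imp_le_of_dense fun s hs => ?_
  rcases le_or_gt s 0 with hs0 | hs0
  · exact hs0.trans (mul_nonneg hC (integral_nonneg fun _ => abs_nonneg _))
  have hvol := lt_volume_of_lt_decRearr hs0.le hs
  have hfatou : volume {x | s < |u x|} ≤
      liminf (fun k => volume {x | s < |φ (ns k) x|}) atTop := by
    have hm : ∀ k, MeasurableSet {x | s < |φ (ns k) x|} := fun k =>
      measurableSet_lt measurable_const (hφ2 _).continuous.measurable.abs
    have hnull : NullMeasurableSet {x | s < |u x|} :=
      nullMeasurableSet_lt aemeasurable_const hui.aestronglyMeasurable.aemeasurable.abs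
    calc volume {x | s < |u x|} = ∫⁻ x, {x | s < |u x|}.indicator 1 x :=
          (lintegral_indicator_one₀ hnull).symm
      _ ≤ ∫⁻ x, liminf (fun k => {x | s < |φ (ns k) x|}.indicator (1 : Euc n → ℝ≥0∞) x) atTop := by
          refine lintegral_mono_ae (hae.mono fun x hx => ?_)
          by_cases hxs : s < |u x|
          · have hev : ∀ᶠ k in atTop,
                {x | s < |φ (ns k) x|}.indicator (1 : Euc n → ℝ≥0∞) x = 1 :=
              (hx.abs.eventually (lt_mem_nhds hxs)).mono fun k hk =>
                Set.indicator_of_mem (s := {x | s < |φ (ns k) x|}) hk _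
            rw [liminf_congr hev, liminf_const]
            exact Set.indicator_le_self' (fun _ _ => zero_le_one) x
          · rw [Set.indicator_of_notMem (s := {x | s < |u x|}) hxs]
            exact zero_le
      _ ≤ liminf (fun k => ∫⁻ x, {x | s < |φ (ns k) x|}.indicator (1 : Euc n → ℝ≥0∞) x) atTop :=
          lintegral_liminf_le fun k => measurable_one.indicator (hm k)
      _ = _ := by simp only [lintegral_indicator_one (hm _)]
  have hev := eventually_lt_of_lt_liminf (hvol.trans_le hfatou)
  refine ge_of_tendsto ((hlim.comp hns.tendsto_atTop).const_mul C) (hev.mono fun k hk => ?_)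
  exact level_le_of_lt_volume_abs hn (hφ2 _) (hφ _).2.1 hs0 ht hk

/-- The Laplacian of a radial function of `‖x‖ ^ 2`. -/
theorem lapl_comp_norm_sq {n : ℕ} {h : ℝ → ℝ} (hh : ContDiff ℝ 2 h) (x : Euc n) :
    lapl n (fun x => h (‖x‖ ^ 2)) x =
      4 * ‖x‖ ^ 2 * deriv (deriv h) (‖x‖ ^ 2) + 2 * n * deriv h (‖x‖ ^ 2) := by
  have hsq : ∀ x : Euc n, HasFDerivAt (fun x : Euc n => ‖x‖ ^ 2) (2 • innerSL ℝ x) x :=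
    fun x => (hasStrictFDerivAt_norm_sq x).hasFDerivAt
  have hd : ContDiff ℝ 1 (deriv h) := by
    have := (contDiff_succ_iff_deriv (n := 1)).1 (by simpa [one_add_one_eq_two] using hh)
    exact this.2.2
  have hin : ∀ (x : Euc n) i, inner ℝ x (EuclideanSpace.single i (1 : ℝ)) = x i := fun x i => by
    simp [EuclideanSpace.inner_single_right]
  have h1 : ∀ (x : Euc n) i, fderiv ℝ (fun x => h (‖x‖ ^ 2)) x (EuclideanSpace.single i 1) =
      deriv h (‖x‖ ^ 2) * (2 * x i) := by
    intro x i
    have := ((hh.differentiable (by norm_num)).differentiableAt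
      (x := ‖x‖ ^ 2)).hasDerivAt.comp_hasFDerivAt x (hsq x)
    refine (congrArg (fun L : Euc n →L[ℝ] ℝ => L (EuclideanSpace.single i 1))
      (HasFDerivAt.fderiv this)).trans ?_
    simp [hin]
  rw [lapl_eq_sum_fderiv (φ := fun x => h (‖x‖ ^ 2)) (hh.comp (contDiff_norm_sq ℝ))]
  simp only [h1]
  have h2 : ∀ i, fderiv ℝ (fun x : Euc n => deriv h (‖x‖ ^ 2) * (2 * x i)) x
      (EuclideanSpace.single i 1) =
      4 * deriv (deriv h) (‖x‖ ^ 2) * x i ^ 2 + 2 * deriv h (‖x‖ ^ 2) := by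
    intro i
    have e1 := ((hd.differentiable (by norm_num)).differentiableAt
      (x := ‖x‖ ^ 2)).hasDerivAt.comp_hasFDerivAt x (hsq x)
    have e2 : HasFDerivAt (fun x : Euc n => 2 * x i)
        ((2 : ℝ) • (EuclideanSpace.proj i : Euc n →L[ℝ] ℝ)) x :=
      (EuclideanSpace.proj i : Euc n →L[ℝ] ℝ).hasFDerivAt.const_mul 2
    refine (congrArg (fun L : Euc n →L[ℝ] ℝ => L (EuclideanSpace.single i 1))
      (HasFDerivAt.fderiv (e1.mul e2))).trans ?_
    simp [hin]
    ring
  simp only [h2]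
  rw [Finset.sum_add_distrib, ← Finset.mul_sum, EuclideanSpace.norm_sq_eq]
  simp
  ring

/-- The profile of a smoothed Newtonian potential, as a function of the squared radius. -/
theorem exists_newton_profile {n : ℕ} (hn : 3 ≤ n) :
    ∃ h m : ℝ → ℝ, (∀ k : ℕ, ContDiff ℝ k h) ∧ ContDiff ℝ 1 m ∧ Monotone m ∧ m 0 = 0 ∧
      (∀ τ, 1 ≤ τ → m τ = 1) ∧ Antitone h ∧
      (∀ ρ, 1 ≤ ρ → h ρ = ρ ^ (1 - (n : ℝ) / 2) / (n - 2)) ∧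
      ∀ ρ, 0 ≤ ρ → 4 * ρ * deriv (deriv h) ρ + 2 * n * deriv h ρ =
        -(2 * (deriv m ρ * ρ ^ (1 - (n : ℝ) / 2))) := by
  have hn3 : (3 : ℝ) ≤ n := by exact_mod_cast hn
  set m : ℝ → ℝ := fun τ => Real.smoothTransition ((4 * τ - 1) / 3) with hm
  have hmc : ∀ k : ℕ, ContDiff ℝ k m := fun k =>
    (Real.smoothTransition.contDiff (n := k)).comp (by fun_prop)
  have hm0 : ∀ τ, τ ≤ 1 / 4 → m τ = 0 := fun τ hτ =>
    Real.smoothTransition.zero_of_nonpos (by linarith)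
  have hm1 : ∀ τ, 1 ≤ τ → m τ = 1 := fun τ hτ =>
    Real.smoothTransition.one_of_one_le (by linarith)
  have hmm : Monotone m := fun a b hab =>
    Real.smoothTransition.monotone (by linarith)
  set ψ : ℝ → ℝ := fun τ => m τ * τ ^ (-((n : ℝ) / 2)) with hψ
  have hψc : ∀ k : ℕ, ContDiff ℝ k ψ := by
    refine fun k => contDiff_iff_contDiffAt.2 fun τ => ?_
    rcases lt_or_ge τ (1 / 4) with h | h
    · refine (contDiffAt_const (c := (0 : ℝ))).congr_of_eventuallyEq ?_
      filter_upwards [gt_mem_nhds h] with y hy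
      simp [hψ, hm0 y hy.le]
    · exact (hmc k).contDiffAt.mul (Real.contDiffAt_rpow_const_of_ne (by positivity))
  have hψ0 : ∀ τ, 0 ≤ ψ τ := by
    intro τ
    rcases le_or_gt τ (1 / 4) with h | h
    · simp [hψ, hm0 τ h]
    · exact mul_nonneg (Real.smoothTransition.nonneg _) (by positivity)
  set h : ℝ → ℝ := fun ρ => 1 / ((n : ℝ) - 2) - (∫ τ in (1 : ℝ)..ρ, ψ τ) / 2 with hh
  have hψcont : Continuous ψ := (hψc 0).continuous
  have hder : ∀ ρ, HasDerivAt h (-(ψ ρ / 2)) ρ := fun ρ =>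
    (((hψcont.integral_hasStrictDerivAt 1 ρ).hasDerivAt.div_const 2).const_sub _)
  have hderiv : deriv h = fun ρ => -(ψ ρ / 2) := funext fun ρ => (hder ρ).deriv
  have hhc : ∀ k : ℕ, ContDiff ℝ k h := by
    intro k
    refine ContDiff.of_le (n := ((k : ℕ) : WithTop ℕ∞) + 1) ?_ (by norm_cast; omega)
    refine contDiff_succ_iff_deriv.2 ⟨fun ρ => (hder ρ).differentiableAt, fun hk => ?_, ?_⟩
    · exact absurd hk (by simp)
    · rw [hderiv]
      exact ((hψc k).div_const 2).neg
  refine ⟨h, m, hhc, hmc 1, hmm, hm0 0 (by norm_num), hm1, ?_, ?_, ?_⟩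
  · refine antitone_of_deriv_nonpos (fun ρ => (hder ρ).differentiableAt) fun ρ => ?_
    rw [hderiv]
    linarith [hψ0 ρ]
  · intro ρ hρ
    have e : ∫ τ in (1 : ℝ)..ρ, ψ τ = ∫ τ in (1 : ℝ)..ρ, τ ^ (-((n : ℝ) / 2)) := by
      refine intervalIntegral.integral_congr fun τ hτ => ?_
      rw [Set.uIcc_of_le hρ] at hτ
      simp [hψ, hm1 τ hτ.1]
    have h0 : (0 : ℝ) ∉ Set.uIcc 1 ρ := by
      rw [Set.uIcc_of_le hρ]; exact fun h => absurd h.1 (by norm_num)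
    simp only [hh]
    rw [e, integral_rpow (Or.inr ⟨by linarith, h0⟩), Real.one_rpow,
      show -((n : ℝ) / 2) + 1 = 1 - (n : ℝ) / 2 by ring]
    have h1 : 1 - (n : ℝ) / 2 ≠ 0 := by linarith
    rw [show (n : ℝ) - 2 = -2 * (1 - (n : ℝ) / 2) by ring]
    generalize 1 - (n : ℝ) / 2 = E at *
    field_simp
    ring
  · intro ρ hρ
    rw [hderiv]
    rcases hρ.eq_or_lt with rfl | hρ
    · simp only [hψ]
      rw [Real.zero_rpow (show 1 - (n : ℝ) / 2 ≠ 0 by linarith), hm0 0 (by norm_num)]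
      simp
    · have hd : HasDerivAt (fun ρ => -(ψ ρ / 2)) (-((deriv m ρ * ρ ^ (-((n : ℝ) / 2)) +
          m ρ * (-((n : ℝ) / 2) * ρ ^ (-((n : ℝ) / 2) - 1))) / 2)) ρ :=
        (((((hmc 1).differentiable (by norm_num)).differentiableAt (x := ρ)).hasDerivAt.mul
          (Real.hasDerivAt_rpow_const (Or.inl hρ.ne'))).div_const 2).neg
      rw [hd.deriv, Real.rpow_sub_one hρ.ne', show 1 - (n : ℝ) / 2 = -((n : ℝ) / 2) + 1 by ring,
        Real.rpow_add_one hρ.ne']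
      simp only [hψ]
      field_simp
      ring

/-- A smooth radial superharmonic function of unit mass that agrees with the Newtonian potential
off the unit ball. -/
theorem exists_newton_potential {n : ℕ} (hn : 3 ≤ n) :
    ∃ Q σ : Euc n → ℝ, (∀ k : ℕ, ContDiff ℝ k Q) ∧ (∀ x, lapl n Q x = -σ x) ∧ Continuous σ ∧
      (∀ x, 0 ≤ σ x) ∧ (∀ x, 1 < ‖x‖ → σ x = 0) ∧ ∫ x, σ x = 1 ∧ (∀ x, 0 ≤ Q x) ∧
      (∀ x y, ‖x‖ ≤ ‖y‖ → Q y ≤ Q x) ∧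
      ∀ x, 1 ≤ ‖x‖ → Q x = cConst n * ‖x‖ ^ (2 - (n : ℝ)) := by
  obtain ⟨h, m, hh, hm, hmm, hm0, hm1, hanti, hfar, hode⟩ := exists_newton_profile hn
  have hn3 : (3 : ℝ) ≤ n := by exact_mod_cast hn
  have hω : 0 < omegaS n := omegaS_pos (by omega)
  set ω := omegaS n with hωd
  set Q : Euc n → ℝ := fun x => h (‖x‖ ^ 2) / ω with hQ
  set σ : Euc n → ℝ := fun x =>
    2 / ω * (deriv m (‖x‖ ^ 2) * (‖x‖ ^ 2) ^ (1 - (n : ℝ) / 2)) with hσ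
  have hQc : ∀ k : ℕ, ContDiff ℝ k Q := fun k =>
    ((hh k).comp (contDiff_norm_sq ℝ)).div_const ω
  have hlapl : ∀ x, lapl n Q x = -σ x := by
    intro x
    have h2 : ContDiff ℝ 2 fun ρ => h ρ / ω := (hh 2).div_const ω
    have e1 : deriv (fun ρ => h ρ / ω) = fun ρ => deriv h ρ / ω := by
      funext ρ; exact deriv_div_const _
    refine (lapl_comp_norm_sq h2 x).trans ?_
    rw [e1, deriv_div_const]
    have := hode (‖x‖ ^ 2) (sq_nonneg _)
    simp only [hσ]
    linear_combination this / ω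
  have hmd : ∀ τ, 0 ≤ deriv m τ := fun τ => hmm.deriv_nonneg
  have hmd1 : ∀ τ, 1 < τ → deriv m τ = 0 := fun τ hτ => by
    have : m =ᶠ[𝓝 τ] fun _ => 1 := by
      filter_upwards [lt_mem_nhds hτ] with y hy using hm1 y hy.le
    rw [this.deriv_eq, deriv_const]
  have hrpow : ∀ r : ℝ, 0 ≤ r → (r ^ 2) ^ (1 - (n : ℝ) / 2) = r ^ (2 - (n : ℝ)) := fun r hr => by
    rw [← Real.rpow_natCast, ← Real.rpow_mul hr]
    congr 1
    push_cast
    ring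
  have hfar' : ∀ x : Euc n, 1 ≤ ‖x‖ → Q x = cConst n * ‖x‖ ^ (2 - (n : ℝ)) := fun x hx => by
    simp only [hQ]
    rw [hfar _ (one_le_pow₀ hx), hrpow _ (norm_nonneg _), cConst, ← hωd]
    have : (n : ℝ) - 2 ≠ 0 := by linarith
    field_simp
  refine ⟨Q, σ, hQc, hlapl, ?_, fun x => ?_, fun x hx => ?_, ?_, fun x => ?_, fun x y hxy => ?_,
    hfar'⟩
  · have : σ = fun x => -lapl n Q x := by funext x; rw [hlapl, neg_neg]
    rw [this]
    exact (continuous_lapl (hQc 2)).neg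
  · exact mul_nonneg (by positivity) (mul_nonneg (hmd _) (by positivity))
  · simp only [hσ, hmd1 _ (one_lt_pow₀ hx two_ne_zero), zero_mul, mul_zero]
  · have : Nontrivial (Euc n) := by
      have : Nonempty (Fin n) := ⟨⟨0, by omega⟩⟩
      infer_instance
    have e := integral_fun_norm_addHaar (volume : Measure (Euc n)) fun r : ℝ =>
      2 / ω * (deriv m (r ^ 2) * (r ^ 2) ^ (1 - (n : ℝ) / 2))
    refine e.trans ?_
    have e2 : ∫ r in Set.Ioi (0 : ℝ), r ^ (Module.finrank ℝ (Euc n) - 1) •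
        (2 / ω * (deriv m (r ^ 2) * (r ^ 2) ^ (1 - (n : ℝ) / 2))) =
        ∫ r in Set.Ioi (0 : ℝ), 1 / ω * (deriv m (r ^ 2) * (2 * r)) := by
      refine setIntegral_congr_fun measurableSet_Ioi fun r (hr : 0 < r) => ?_
      simp only [finrank_euclideanSpace_fin, smul_eq_mul]
      rw [hrpow r hr.le]
      have : r ^ (n - 1) * r ^ (2 - (n : ℝ)) = r := by
        rw [← Real.rpow_natCast, ← Real.rpow_add hr, Nat.cast_sub (by omega)]
        ring_nf
        exact Real.rpow_one r
      linear_combination (2 / ω * deriv m (r ^ 2)) * this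
    have hdr : ∀ r : ℝ, HasDerivAt (fun r => m (r ^ 2)) (deriv m (r ^ 2) * (2 * r)) r := fun r => by
      have h2 : HasDerivAt (fun r : ℝ => r ^ 2) (2 * r) r := by simpa using hasDerivAt_pow 2 r
      exact ((hm.differentiable (by norm_num)).differentiableAt (x := r ^ 2)).hasDerivAt.comp r h2
    have e3 : ∫ r in Set.Ioi (0 : ℝ), deriv m (r ^ 2) * (2 * r) = 1 - m (0 ^ 2) := by
      refine integral_Ioi_of_hasDerivAt_of_nonneg (g := fun r => m (r ^ 2))
        (hdr 0).continuousAt.continuousWithinAt (fun r _ => hdr r)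
        (fun r (hr : 0 < r) => mul_nonneg (hmd _) (by positivity)) ?_
      refine tendsto_const_nhds.congr' ?_
      filter_upwards [eventually_ge_atTop 1] with r hr
      exact (hm1 _ (one_le_pow₀ hr)).symm
    rw [e2, integral_const_mul, e3, measureReal_def, volume_unit_ball_eq_omegaS_div (by omega),
      ENNReal.toReal_ofReal (by positivity), finrank_euclideanSpace_fin, ← hωd]
    simp [hm0]
    field_simp
  · refine (div_nonneg ?_ hω.le).trans (div_le_div_of_nonneg_right
      (hanti (le_max_left (‖x‖ ^ 2) 1)) hω.le)
    rw [hfar _ (le_max_right _ _)]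
    exact div_nonneg (by positivity) (by linarith)
  · exact div_le_div_of_nonneg_right (hanti (by gcongr)) hω.le

/-- The Laplacian under dilations and translations. -/
theorem lapl_const_mul_comp_smul_sub {n : ℕ} {u : Euc n → ℝ} (hu : ContDiff ℝ 2 u) (a b : ℝ)
    (p x : Euc n) :
    lapl n (fun y => a * u (b • (y - p))) x = a * b ^ 2 * lapl n u (b • (x - p)) := by
  have key : ∀ {g : Euc n → ℝ} (_ : Differentiable ℝ g) (a : ℝ) (x v : Euc n),
      fderiv ℝ (fun y => a * g (b • (y - p))) x v = a * b * fderiv ℝ g (b • (x - p)) v := by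
    intro g hg a x v
    have h1 : HasFDerivAt (fun y : Euc n => b • (y - p)) (b • ContinuousLinearMap.id ℝ (Euc n)) x :=
      ((hasFDerivAt_id x).sub_const p).const_smul b
    have h2 := ((hg (b • (x - p))).hasFDerivAt.comp x h1).const_mul a
    refine (congrArg (fun L : Euc n →L[ℝ] ℝ => L v) (HasFDerivAt.fderiv h2)).trans ?_
    simp
    ring
  have hc : ContDiff ℝ 2 fun y : Euc n => a * u (b • (y - p)) :=
    contDiff_const.mul (hu.comp (by fun_prop))
  rw [lapl_eq_sum_fderiv hc, lapl_eq_sum_fderiv hu, Finset.mul_sum]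
  refine Finset.sum_congr rfl fun i _ => ?_
  simp only [key (hu.differentiable (by norm_num))]
  have hd : Differentiable ℝ fun y => fderiv ℝ u y (EuclideanSpace.single i (1 : ℝ)) :=
    ((hu.fderiv_right (m := 1) (by norm_num)).differentiable (by norm_num)).clm_apply
      (differentiable_const _)
  rw [key hd]
  ring

theorem integral_pow_mul_comp_smul {n : ℕ} (F : Euc n → ℝ) {b : ℝ} (hb : 0 < b) :
    ∫ x, b ^ n * F (b • x) = ∫ x, F x := by
  rw [integral_const_mul, Measure.integral_comp_smul, finrank_euclideanSpace_fin,
    abs_of_pos (by positivity), smul_eq_mul]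
  field_simp

/-- Translates of a compactly supported continuous function are `L¹`-close. -/
theorem tendsto_integral_abs_translate_sub {n : ℕ} {σ : Euc n → ℝ} (hσ : Continuous σ)
    (hσ0 : ∀ x, 1 < ‖x‖ → σ x = 0) (p q : Euc n) :
    Tendsto (fun b : ℝ => ∫ y, |σ (y - b • p) - σ (y - b • q)|) (𝓝 0) (𝓝 0) := by
  have hk : IsCompact (Metric.closedBall (0 : Euc n) (1 + ‖p‖ + ‖q‖)) := isCompact_closedBall _ _
  have hz : ∀ (b : ℝ) (y v : Euc n), b ∈ Set.Icc (-1 : ℝ) 1 → ‖v‖ ≤ ‖p‖ + ‖q‖ →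
      y ∉ Metric.closedBall (0 : Euc n) (1 + ‖p‖ + ‖q‖) → σ (y - b • v) = 0 := by
    intro b y v hb hv hy
    rw [mem_closedBall_zero_iff, not_le] at hy
    refine hσ0 _ ?_
    have h1 : ‖b • v‖ ≤ ‖v‖ := by
      rw [norm_smul]
      exact mul_le_of_le_one_left (norm_nonneg _) (abs_le.2 hb)
    have := norm_sub_norm_le y (b • v)
    linarith
  have hc := continuousOn_integral_of_compact_support (μ := (volume : Measure (Euc n)))
    (f := fun (b : ℝ) (y : Euc n) => |σ (y - b • p) - σ (y - b • q)|) (s := Set.Icc (-1) 1) hk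
    (by
      refine Continuous.continuousOn ?_
      simp only [Function.uncurry_def]
      fun_prop)
    (fun b y hb hy => by
      rw [hz b y p hb (by linarith [norm_nonneg q]) hy, hz b y q hb (by linarith [norm_nonneg p]) hy]
      simp)
  have := (hc.continuousAt (x := 0) (Icc_mem_nhds (by norm_num) (by norm_num))).tendsto
  simpa using this

/-- Test functions close to the difference of two smoothed Newtonian potentials, whose Laplacian
has total mass close to `2`. -/
theorem exists_testFun_near_dipole {n : ℕ} (hn : 3 ≤ n) {r : ℝ} (hr : 0 < r) :
    ∃ T : Euc n → ℝ, (∀ x ρ, r ≤ ρ → ‖x‖ ≤ ρ → cConst n * ρ ^ (2 - (n : ℝ)) ≤ T x) ∧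
      (∀ x ρ, r ≤ ρ → ρ ≤ ‖x‖ → T x ≤ cConst n * ρ ^ (2 - (n : ℝ))) ∧
      ∀ (p q : Euc n) (ε : ℝ), 0 < ε → ∃ u : Euc n → ℝ, IsTestFun n Set.univ u ∧
        ∫ x, |lapl n u x| ≤ 2 + ε ∧ ∀ x, |u x - (T (x - p) - T (x - q))| ≤ ε := by
  obtain ⟨Q, σ, hQ, hlapl, hσc, hσ0, hσz, hσ1, hQ0, hmono, hfar⟩ := exists_newton_potential hn
  have hn3 : (3 : ℝ) ≤ n := by exact_mod_cast hn
  have hcC : 0 ≤ cConst n := by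
    have := (omegaS_pos (n := n) (by omega)).le
    have : (0 : ℝ) ≤ n - 2 := by linarith
    unfold cConst
    positivity
  have hPfar : ∀ (b : ℝ) (x : Euc n), 0 < b → 1 / b ≤ ‖x‖ →
      b ^ (n - 2) * Q (b • x) = cConst n * ‖x‖ ^ (2 - (n : ℝ)) := by
    intro b x hb hx
    have e : ‖b • x‖ = b * ‖x‖ := by rw [norm_smul, Real.norm_of_nonneg hb.le]
    have h1 : 1 ≤ ‖b • x‖ := by rw [e, mul_comm]; exact (div_le_iff₀ hb).1 hx
    rw [hfar _ h1, e, Real.mul_rpow hb.le (norm_nonneg _)]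
    have : b ^ (n - 2) * b ^ (2 - (n : ℝ)) = 1 := by
      rw [← Real.rpow_natCast, ← Real.rpow_add hb, Nat.cast_sub (by omega)]
      norm_num
    linear_combination cConst n * ‖x‖ ^ (2 - (n : ℝ)) * this
  set b₀ := 1 / r with hb₀
  have hb₀p : 0 < b₀ := by positivity
  have hb₀r : 1 / b₀ = r := by simp [hb₀]
  set T : Euc n → ℝ := fun x => b₀ ^ (n - 2) * Q (b₀ • x) with hT
  have hTfar : ∀ x, r ≤ ‖x‖ → T x = cConst n * ‖x‖ ^ (2 - (n : ℝ)) := fun x hx =>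
    hPfar b₀ x hb₀p (by rwa [hb₀r])
  refine ⟨T, fun x ρ hρ hx => ?_, fun x ρ hρ hx => ?_, fun p q ε hε => ?_⟩
  · have hρ0 : 0 < ρ := hr.trans_le hρ
    let y : Euc n := EuclideanSpace.single ⟨0, by omega⟩ ρ
    have hy : ‖y‖ = ρ := by simp [y, abs_of_pos hρ0]
    have h1 := hTfar y (by rwa [hy])
    rw [hy] at h1
    rw [← h1]
    refine mul_le_mul_of_nonneg_left (hmono _ _ ?_) (by positivity)
    rw [norm_smul, norm_smul, hy]
    gcongr
  · rw [hTfar x (hρ.trans hx)]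
    exact mul_le_mul_of_nonneg_left
      (Real.rpow_le_rpow_of_nonpos (hr.trans_le hρ) hx (by linarith)) hcC
  have htend := tendsto_integral_abs_translate_sub hσc hσz p q
  have hpow : Tendsto (fun b : ℝ => b ^ (n - 2) * Q 0) (𝓝 0) (𝓝 0) := by
    have : Continuous fun b : ℝ => b ^ (n - 2) * Q 0 := by fun_prop
    have := this.tendsto 0
    rwa [zero_pow (by omega), zero_mul] at this
  have hevent : ∀ᶠ b : ℝ in 𝓝[>] 0, 0 < b ∧
      ∫ y, |σ (y - b • p) - σ (y - b • q)| < ε ∧ b ^ (n - 2) * Q 0 < ε :=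
    (eventually_mem_nhdsWithin).and (nhdsWithin_le_nhds
      ((htend.eventually (gt_mem_nhds hε)).and (hpow.eventually (gt_mem_nhds hε))))
  obtain ⟨b, hb, hbσ, hbQ⟩ := hevent.exists
  set P : ℝ → Euc n → Euc n → ℝ := fun b p x => b ^ (n - 2) * Q (b • (x - p)) with hP
  set S : ℝ → Euc n → Euc n → ℝ := fun b p x => b ^ n * σ (b • (x - p)) with hS
  have hPc : ∀ b p (k : ℕ), ContDiff ℝ k (P b p) := fun b p k =>
    contDiff_const.mul ((hQ k).comp (by fun_prop))
  have hPl : ∀ b p x, lapl n (P b p) x = -S b p x := fun b p x => by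
    simp only [hP, hS]
    rw [lapl_const_mul_comp_smul_sub (hQ 2), hlapl, ← pow_add, show n - 2 + 2 = n by omega]
    ring
  have hPbd : ∀ p x, 0 ≤ P b p x ∧ P b p x ≤ b ^ (n - 2) * Q 0 := fun p x =>
    ⟨mul_nonneg (by positivity) (hQ0 _),
      mul_le_mul_of_nonneg_left (hmono _ _ (by simp)) (by positivity)⟩
  have hSc : ∀ b p, Continuous (S b p) := fun b p => by fun_prop
  have hS0 : ∀ b p x, 0 < b → 0 ≤ S b p x := fun b p x hb => mul_nonneg (by positivity) (hσ0 _)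
  have hσi : Integrable σ := by
    refine hσc.integrable_of_hasCompactSupport
      (HasCompactSupport.intro (isCompact_closedBall (0 : Euc n) 1) fun x hx => hσz x ?_)
    rwa [mem_closedBall_zero_iff, not_le] at hx
  have hSi : ∀ b p, 0 < b → Integrable (S b p) := fun b p hb =>
    (((hσi.comp_smul hb.ne').const_mul (b ^ n)).comp_sub_right p)
  have hSint : ∀ b p, 0 < b → ∫ x, S b p x = 1 := fun b p hb => by
    rw [← hσ1, ← integral_pow_mul_comp_smul σ hb]
    exact integral_sub_right_eq_self (fun x => b ^ n * σ (b • x)) p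
  have hSdiff : ∫ x, |S b p x - S b q x| < ε := by
    refine lt_of_le_of_lt (le_of_eq ?_) hbσ
    rw [← integral_pow_mul_comp_smul (fun y => |σ (y - b • p) - σ (y - b • q)|) hb]
    refine integral_congr_ae (ae_of_all _ fun x => ?_)
    simp only [hS, smul_sub]
    rw [← mul_sub, abs_mul, abs_of_pos (by positivity : (0 : ℝ) < b ^ n)]
  set u : Euc n → ℝ := fun x => (P b₀ p x - P b p x) - (P b₀ q x - P b q x) with hu
  have huc : ∀ k : ℕ, ContDiff ℝ k u := fun k =>
    ((hPc _ _ k).sub (hPc _ _ k)).sub ((hPc _ _ k).sub (hPc _ _ k))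
  have hul : ∀ x, lapl n u x = -S b₀ p x + S b₀ q x + (S b p x - S b q x) := by
    intro x
    have hsub : ∀ {f g : Euc n → ℝ} (_ : ContDiff ℝ 2 f) (_ : ContDiff ℝ 2 g),
        lapl n (fun y => f y - g y) x = lapl n f x - lapl n g x := by
      intro f g hf hg
      unfold lapl
      rw [← Finset.sum_sub_distrib]
      refine Finset.sum_congr rfl fun i _ => ?_
      have := iteratedFDeriv_sub_apply (x := x) hf.contDiffAt hg.contDiffAt
      exact congrArg (fun M : ContinuousMultilinearMap ℝ (fun _ : Fin 2 => Euc n) ℝ =>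
        M ![EuclideanSpace.single i (1 : ℝ), EuclideanSpace.single i (1 : ℝ)]) this
    rw [hu, hsub ((hPc _ _ 2).sub (hPc _ _ 2)) ((hPc _ _ 2).sub (hPc _ _ 2)),
      hsub (hPc _ _ 2) (hPc _ _ 2), hsub (hPc _ _ 2) (hPc _ _ 2), hPl, hPl, hPl, hPl]
    ring
  refine ⟨u, ⟨contDiff_infty.2 huc, ?_, Set.subset_univ _⟩, ?_, fun x => ?_⟩
  · set D := 1 / b₀ + 1 / b with hD
    have h0 : ∀ v x : Euc n, D ≤ ‖x - v‖ → P b₀ v x - P b v x = 0 := fun v x hx => by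
      have h1 : 0 < 1 / b₀ := by positivity
      have h2 : 0 < 1 / b := by positivity
      simp only [hP]
      rw [hPfar b₀ _ hb₀p (by linarith), hPfar b _ hb (by linarith), sub_self]
    refine HasCompactSupport.intro (isCompact_closedBall (0 : Euc n) (D + ‖p‖ + ‖q‖)) fun x hx => ?_
    rw [mem_closedBall_zero_iff, not_le] at hx
    have hp := norm_sub_norm_le x p
    have hq := norm_sub_norm_le x q
    have := norm_nonneg p
    have := norm_nonneg q
    simp only [hu]
    rw [h0 p x (by linarith), h0 q x (by linarith), sub_zero]
  · calc ∫ x, |lapl n u x| ≤ ∫ x, (S b₀ p x + S b₀ q x + |S b p x - S b q x|) := by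
          refine integral_mono_of_nonneg (ae_of_all _ fun _ => abs_nonneg _)
            (((hSi _ _ hb₀p).add (hSi _ _ hb₀p)).add ((hSi _ _ hb).sub (hSi _ _ hb)).abs)
            (ae_of_all _ fun x => ?_)
          simp only [hul]
          refine (abs_add_le _ _).trans (add_le_add_left ((abs_add_le _ _).trans ?_) _)
          rw [abs_neg, abs_of_nonneg (hS0 _ _ _ hb₀p), abs_of_nonneg (hS0 _ _ _ hb₀p)]
      _ = (∫ x, S b₀ p x) + (∫ x, S b₀ q x) + ∫ x, |S b p x - S b q x| := by
          rw [← integral_add (hSi _ _ hb₀p) (hSi _ _ hb₀p)]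
          exact integral_add ((hSi _ _ hb₀p).add (hSi _ _ hb₀p))
            ((hSi _ _ hb).sub (hSi _ _ hb)).abs
      _ ≤ 2 + ε := by
          rw [hSint _ _ hb₀p, hSint _ _ hb₀p]
          linarith
  · have h1 := hPbd p x
    have h2 := hPbd q x
    have e : u x - (T (x - p) - T (x - q)) = P b q x - P b p x := by
      simp only [hu, hT, hP]; ring
    rw [e, abs_le]
    constructor <;> linarith

theorem exists_testFun_lt_volume {n : ℕ} (hn : 3 ≤ n) {s t ε : ℝ} (ht : 0 < t)
    (hs : s < NstarInf n (t / 2)) (hε : 0 < ε) :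
    ∃ u : Euc n → ℝ, IsTestFun n Set.univ u ∧ ∫ x, |lapl n u x| ≤ 2 + ε ∧
      ENNReal.ofReal t < volume {x | s < |u x|} := by
  obtain ⟨κ, hκ, hκn, hκv⟩ := exists_ball_scale (n := n) (by omega)
  have hn0 : (0 : ℝ) < n := by positivity
  have hn3 : (3 : ℝ) ≤ n := by exact_mod_cast hn
  set r : ℝ := (t / 2) ^ ((n : ℝ)⁻¹) / κ with hrd
  have hr : 0 < r := by positivity
  have hκr : (κ * r) ^ n = t / 2 := by
    rw [hrd, mul_div_cancel₀ _ hκ.ne', Real.rpow_inv_natCast_pow (by positivity) (by omega)]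
  have hN : NstarInf n (t / 2) = cConst n * r ^ (2 - (n : ℝ)) := by
    unfold NstarInf
    rw [← hκr, ← hκn, mul_assoc, mul_pow, Real.mul_rpow (by positivity) (by positivity), ← mul_assoc,
      ← mul_assoc, mul_assoc (cConst n), ← Real.rpow_add (by positivity), add_neg_cancel,
      Real.rpow_zero, mul_one, ← Real.rpow_natCast r, ← Real.rpow_mul hr.le]
    congr 2
    field_simp
    ring
  rw [hN] at hs
  obtain ⟨s', hss', hs'⟩ := exists_between hs
  set η := (s' - s) / 2 with hη
  have hη0 : 0 < η := by rw [hη]; linarith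
  obtain ⟨T, hTnear, hTfar, hT⟩ := exists_testFun_near_dipole hn hr
  have hcont : ContinuousAt (fun ρ : ℝ => cConst n * ρ ^ (2 - (n : ℝ))) r :=
    (Real.continuousAt_rpow_const _ _ (Or.inl hr.ne')).const_mul _
  obtain ⟨r', hr', hr's⟩ : ∃ r', s' < cConst n * r' ^ (2 - (n : ℝ)) ∧ r < r' :=
    (((hcont.eventually (lt_mem_nhds hs')).filter_mono nhdsWithin_le_nhds).and
      (eventually_mem_nhdsWithin (s := Set.Ioi r))).exists
  have hlim : Tendsto (fun ρ : ℝ => cConst n * ρ ^ (2 - (n : ℝ))) atTop (𝓝 0) := by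
    have := (tendsto_rpow_neg_atTop (y := (n : ℝ) - 2) (by linarith)).const_mul (cConst n)
    simpa using this
  obtain ⟨d, hd, hdr⟩ :=
    ((hlim.eventually (gt_mem_nhds hη0)).and (eventually_ge_atTop r')).exists
  have hr'0 : 0 < r' := hr.trans hr's
  let q : Euc n := EuclideanSpace.single ⟨0, by omega⟩ (r' + d)
  have hq : ‖q‖ = r' + d := by simp [q, abs_of_pos (by linarith : 0 < r' + d)]
  obtain ⟨u, hu, huL, huT⟩ := hT 0 q (min ε η) (lt_min hε hη0)
  refine ⟨u, hu, huL.trans (by linarith [min_le_left ε η]), ?_⟩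
  have hdiff : ∀ x y : Euc n, ‖x‖ ≤ r' → d ≤ ‖y‖ → s + η < T x - T y := fun x y hx hy => by
    have h1 := hTnear x r' hr's.le hx
    have h2 := hTfar y d (hr's.le.trans hdr) hy
    have : s' = s + 2 * η := by rw [hη]; ring
    linarith
  have hsub : Metric.ball (0 : Euc n) r' ∪ Metric.ball q r' ⊆ {x | s < |u x|} := by
    rintro x (hx | hx)
    · rw [mem_ball_zero_iff] at hx
      have h1 := hdiff (x - 0) (x - q) (by simpa using hx.le)
        (by have := norm_sub_norm_le q x; rw [norm_sub_rev] at this; linarith)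
      have h2 := abs_le.1 (huT x)
      have := min_le_right ε η
      exact lt_of_lt_of_le (by linarith) (le_abs_self (u x))
    · rw [mem_ball_iff_norm] at hx
      have h1 := hdiff (x - q) (x - 0) hx.le (by
        have := norm_sub_norm_le q (q - x)
        rw [norm_sub_rev q x, sub_sub_cancel] at this
        rw [sub_zero]; linarith)
      have h2 := abs_le.1 (huT x)
      have := min_le_right ε η
      exact lt_of_lt_of_le (by linarith) (neg_le_abs (u x))
  have hdisj : Disjoint (Metric.ball (0 : Euc n) r') (Metric.ball q r') :=
    Metric.ball_disjoint_ball (by rw [dist_zero_left, hq]; linarith)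
  refine lt_of_lt_of_le ?_ (measure_mono hsub)
  rw [measure_union hdisj measurableSet_ball, Measure.addHaar_ball_of_pos _ _ hr'0,
    Measure.addHaar_ball_of_pos _ _ hr'0, hκv, finrank_euclideanSpace_fin,
    ← ENNReal.ofReal_mul (by positivity), ← ENNReal.ofReal_add (by positivity) (by positivity),
    ENNReal.ofReal_lt_ofReal_iff (by positivity)]
  have h1 : (κ * r) ^ n < (κ * r') ^ n := by gcongr
  rw [hκr, mul_pow] at h1
  linarith

theorem IsTestFun.memW21Delta0 {n : ℕ} {u : Euc n → ℝ} (hu : IsTestFun n Set.univ u) :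
    MemW21Delta0 n Set.univ u (lapl n u) := by
  have h2 : ContDiff ℝ 2 u := contDiff_infty.1 hu.1 2
  refine ⟨(h2.continuous.integrable_of_hasCompactSupport hu.2.1).integrableOn,
    ((continuous_lapl h2).integrable_of_hasCompactSupport
      (hasCompactSupport_lapl hu.2.1)).integrableOn, fun _ => u, fun _ => hu, ?_, ?_⟩ <;> simp

/-- For n ≥ 3 and each fixed t > 0, the supremum of u*(t)/‖Δu‖₁ over
u ∈ W^{2,1}_{Δ,0}(ℝⁿ) with Δu ≠ 0 equals 2^{-2/n} N*_∞(t). -/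
theorem stmt_8 (n : ℕ) (hn : 3 ≤ n) (t : ℝ) (ht : 0 < t) :
    sSup {r : ℝ | ∃ u f : Euc n → ℝ,
      MemW21Delta0 n Set.univ u f ∧ L1norm n Set.univ f ≠ 0 ∧
      r = decRearr n Set.univ u t / L1norm n Set.univ f}
      = (2 : ℝ) ^ (-(2 / (n : ℝ))) * NstarInf n t := by
  have hexists : ∀ s ε : ℝ, 0 < s → s < NstarInf n (t / 2) → 0 < ε → ∃ u f : Euc n → ℝ,
      MemW21Delta0 n Set.univ u f ∧ 0 < L1norm n Set.univ f ∧
      s / (2 + ε) ≤ decRearr n Set.univ u t / L1norm n Set.univ f := by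
    intro s ε hs hsN hε
    obtain ⟨u, hu, huL, huv⟩ := exists_testFun_lt_volume hn ht hsN hε
    have hL : L1norm n Set.univ (lapl n u) ≤ 2 + ε := by simpa [L1norm] using huL
    have hL0 : 0 ≤ L1norm n Set.univ (lapl n u) := integral_nonneg fun _ => abs_nonneg _
    have hdec : s ≤ decRearr n Set.univ u t :=
      le_decRearr_of_lt_volume (hu.2.1.exists_bound_of_continuous hu.1.continuous) huv
    have hLpos : 0 < L1norm n Set.univ (lapl n u) := by
      refine hL0.lt_of_ne fun h => ?_
      have := decRearr_le hn hu.memW21Delta0 ht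
      rw [← h, mul_zero] at this
      linarith
    exact ⟨u, lapl n u, hu.memW21Delta0, hLpos, div_le_div₀ (hs.le.trans hdec) hdec hLpos hL⟩
  have hNpos : 0 < NstarInf n (t / 2) := by
    obtain ⟨κ, hκ, hκn, -⟩ := exists_ball_scale (n := n) (by omega)
    have hn3 : (3 : ℝ) ≤ n := by exact_mod_cast hn
    have : (0 : ℝ) < n - 2 := by linarith
    rw [NstarInf_eq hn hκ hκn]
    positivity
  refine csSup_eq_of_forall_le_of_forall_lt_exists_gt ?_ ?_ ?_
  · obtain ⟨u, f, huf, hf, -⟩ := hexists (NstarInf n (t / 2) / 2) 1 (by linarith) (by linarith)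
      one_pos
    exact ⟨_, u, f, huf, hf.ne', rfl⟩
  · rintro _ ⟨u, f, huf, hf, rfl⟩
    have hf0 : 0 < L1norm n Set.univ f :=
      (integral_nonneg fun _ => abs_nonneg _).lt_of_ne' hf
    rw [div_le_iff₀ hf0]
    exact decRearr_le hn huf ht
  · intro w hw
    rw [two_rpow_mul_NstarInf hn ht] at hw
    obtain ⟨s, hws, hsN⟩ := exists_between (show max (2 * w) 0 < NstarInf n (t / 2) from
      max_lt (by linarith) hNpos)
    have hs : 0 < s := (le_max_right _ _).trans_lt hws
    have hws' : 2 * w < s := (le_max_left _ _).trans_lt hws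
    set ε := (s - 2 * w) / (2 * (|w| + 1)) with hε
    have hw1 : 0 < 2 * (|w| + 1) := by positivity
    have hε0 : 0 < ε := div_pos (by linarith) hw1
    obtain ⟨u, f, huf, hf, hle⟩ := hexists s ε hs hsN hε0
    refine ⟨_, ⟨u, f, huf, hf.ne', rfl⟩, lt_of_lt_of_le ?_ hle⟩
    rw [lt_div_iff₀ (by linarith)]
    have h1 : ε * (2 * (|w| + 1)) = s - 2 * w := div_mul_cancel₀ _ hw1.ne'
    nlinarith [le_abs_self w, abs_nonneg w]
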